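/- Let f be a slice regular self-map of 𝔹 which is not of the form ℳ_{p'} u with p' ∈ 𝔹 and |u| = 1, and let p, s ∈ 𝔹. Then equality |(ℳ_{f⋆_p(s)} ∙ f⋆_p)(q)| = |ℳ_s(q)| holds for some q ∈ 𝔹 with q ≠ s if and only if f is a regular Blaschke product of degree 2, and in that case equality holds for every q ∈ 𝔹. -/

import Mathlib

noncomputable section

abbrev H : Type := Quaternion ℝ

namespace QPaper

/-- The complex slice determined by `I`: the real span of `1` and `I`. -/
def sliceSet (I : H) : Set H := {q | ∃ x y : ℝ, q = (x : H) + y • I}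

/-- Evaluation of the power series `q ↦ ∑ qᵐ aₘ` with right coefficients. -/
def evalC (a : ℕ → H) (q : H) : H := ∑' m, q ^ m * a m

/-- The series with coefficients `a` converges at every point of the unit ball. -/
def SummableOn (a : ℕ → H) : Prop := ∀ q : H, ‖q‖ < 1 → Summable fun m => q ^ m * a m

/-- `a` are the coefficients of a slice regular self-map of the unit ball. -/
def SelfMap (a : ℕ → H) : Prop :=
  SummableOn a ∧ ∀ q : H, ‖q‖ < 1 → ‖evalC a q‖ < 1

/-- Coefficients of the ∗-product. -/
def starMulC (a b : ℕ → H) : ℕ → H := fun m => ∑ ℓ ∈ Finset.range (m + 1), a (m - ℓ) * b ℓ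

/-- Coefficients of the ∗-inverse (of a series with invertible constant term). -/
def starInvC (a : ℕ → H) : ℕ → H
  | 0 => (a 0)⁻¹
  | m + 1 => -(a 0)⁻¹ * ∑ ℓ : Fin (m + 1), a (m + 1 - ℓ.val) * starInvC a ℓ.val
  decreasing_by exact ℓ.isLt

/-- Coefficients of `1 - q p̄`. -/
def oneMinusQPbarC (p : H) : ℕ → H := fun m => if m = 0 then 1 else if m = 1 then -(star p) else 0

/-- Coefficients of `q - p`. -/
def qMinusPC (p : H) : ℕ → H := fun m => if m = 0 then -p else if m = 1 then 1 else 0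

/-- Coefficients of the regular Möbius transformation `ℳ_p = (1 - q p̄)^{-∗} ∗ (q - p)`. -/
def mobiusC (p : H) : ℕ → H := starMulC (starInvC (oneMinusQPbarC p)) (qMinusPC p)

/-- Coefficients of `ℳ_{t₁} ∗ ⋯ ∗ ℳ_{t_κ}`. -/
def blaschkeListC : List H → (ℕ → H)
  | [] => fun m => if m = 0 then 1 else 0
  | t :: ts => starMulC (mobiusC t) (blaschkeListC ts)

/-- `a` are the coefficients of a regular Blaschke product of degree `κ`,
i.e. of `ℳ_{t₁} ∗ ⋯ ∗ ℳ_{t_κ} u` with the `tᵢ` in `𝔹` and `u` unimodular. -/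
def IsBlaschke (a : ℕ → H) (κ : ℕ) : Prop :=
  ∃ (ts : List H) (u : H), ts.length = κ ∧ (∀ t ∈ ts, ‖t‖ < 1) ∧ ‖u‖ = 1 ∧
    a = fun m => blaschkeListC ts m * u

/-- Coefficients of `ℳ_w ∙ f = (1 - f w̄)^{-∗} ∗ (f - w)`. -/
def bulletC (w : H) (a : ℕ → H) : ℕ → H :=
  starMulC (starInvC (fun m => (if m = 0 then (1 : H) else 0) - a m * star w))
    (fun m => a m - if m = 0 then w else 0)

/-- Coefficients of the regular difference quotient `ℛ_{f,p}`,
the unique slice regular function with `f(q) = f(p) + (q - p) ∗ ℛ_{f,p}(q)`. -/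
def diffQuotC (a : ℕ → H) (p : H) : ℕ → H := fun m => ∑' k, p ^ k * a (k + m + 1)

/-- Coefficients of the hyperbolic difference quotient
`f⋆_p = (1 - q p̄) ∗ ℛ_{f,p} ∗ (1 - \overline{f(p)} f)^{-∗} = ℳ_p^{-∗} ∗ (ℳ_{f(p)} ∙ f)`. -/
def hdqC (a : ℕ → H) (p : H) : ℕ → H :=
  starMulC (starMulC (oneMinusQPbarC p) (diffQuotC a p))
    (starInvC (fun m => (if m = 0 then (1 : H) else 0) - star (evalC a p) * a m))

/-- Iterated hyperbolic difference quotients: `ihdqC a [p₁, …, pₙ] = ((f⋆_{p₁})⋆_{p₂} ⋯)⋆_{pₙ}`. -/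
def ihdqC (a : ℕ → H) : List H → (ℕ → H)
  | [] => a
  | p :: ps => ihdqC (hdqC a p) ps

/-- `𝒯_p(q) = (1 - q p)⁻¹ q (1 - q p)`. -/
def mobiusT (p q : H) : H := (1 - q * p)⁻¹ * q * (1 - q * p)

/-- `M_p(q) = (1 - q p̄)⁻¹ (q - p)`. -/
def mobiusM (p q : H) : H := (1 - q * star p)⁻¹ * (q - p)

/-- Pointwise evaluation of the regular Möbius transformation: `ℳ_p(q) = M_p(𝒯_p(q))`. -/
def mobiusEval (p q : H) : H := mobiusM p (mobiusT p q)

/-- The pseudo-hyperbolic distance `ρ(p,q) = |M_p(q)|`. -/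
def rho (p q : H) : ℝ := ‖mobiusM p q‖

/-- The Poincaré distance `δ(p,q) = tanh⁻¹ ρ(p,q) = ½ log((1+ρ)/(1−ρ))`. -/
def pdist (p q : H) : ℝ := (1/2 : ℝ) * Real.log ((1 + rho p q) / (1 - rho p q))

section
open PowerSeries

abbrev PS : Type := PowerSeries H

def lin (p : H) : PS := X - C p
def den (p : H) : PS := 1 - X * C (star p)
def ev (F : PS) (q : H) : H := evalC (fun m => coeff m F) q
def NN (n : ℕ) (F : PS) : ℝ := ∑ m ∈ Finset.range n, ‖coeff m F‖ ^ 2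
def Schur (F : PS) : Prop := ∀ n k, NN n (F * k) ≤ NN n k
/-- the defining relation of the hyperbolic difference quotient -/
def HD (F : PS) (p w : H) (g : PS) : Prop :=
  lin p * g * (1 - C (star w) * F) = den p * (F - C w)
def IsMob (F : PS) : Prop := ∃ t u : H, ‖t‖ < 1 ∧ ‖u‖ = 1 ∧ den t * F = lin t * C u

theorem CX (a : H) : (C a : PS) * X = X * C a := (commute_X _).eq
theorem CX' (a : H) (F : PS) : (C a : PS) * (X * F) = X * (C a * F) := by
  rw [← mul_assoc, CX, mul_assoc]
theorem FX (F : PS) : F * X = X * F := (commute_X _).eq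
theorem FX' (F G : PS) : F * (X * G) = X * (F * G) := by
  rw [← mul_assoc, FX, mul_assoc]

theorem sq_star (p : H) : p * star p = ((‖p‖ ^ 2 : ℝ) : H) := by
  rw [Quaternion.self_mul_star, Quaternion.normSq_eq_norm_mul_self, sq]
theorem star_sq (p : H) : star p * p = ((‖p‖ ^ 2 : ℝ) : H) := by
  rw [Quaternion.star_mul_self, Quaternion.normSq_eq_norm_mul_self, sq]
theorem star_comm' (p : H) : star p * p = p * star p := by rw [sq_star, star_sq]

theorem lin_den (p : H) : lin p * den p = den p * lin p := by
  have h : (C (star p) : PS) * C p = C p * C (star p) := by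
    rw [← map_mul, ← map_mul, star_comm']
  simp only [lin, den, mul_sub, sub_mul, mul_one, one_mul, mul_assoc, CX, CX', h]
  abel

theorem den_ne (p : H) : den p ≠ 0 := by
  intro h
  have := congrArg (coeff 0) h
  simp [den] at this
theorem lin_ne (p : H) : lin p ≠ 0 := by
  intro h
  have := congrArg (coeff 1) h
  simp [lin] at this

theorem mk_starMul (a b : ℕ → H) : (mk (starMulC a b) : PS) = mk a * mk b := by
  ext1 n
  rw [coeff_mul, coeff_mk, starMulC, ← Finset.Nat.sum_antidiagonal_swap,
    Finset.Nat.sum_antidiagonal_eq_sum_range_succ_mk]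
  simp

theorem mk_starInv (a : ℕ → H) (h : a 0 ≠ 0) : (mk a : PS) * mk (starInvC a) = 1 := by
  rw [← mk_starMul]
  ext1 n
  rw [coeff_mk, starMulC, coeff_one]
  cases n with
  | zero => simp [starInvC, h]
  | succ n =>
    rw [Finset.sum_range_succ]
    simp only [Nat.sub_self]
    rw [starInvC, Fin.sum_univ_eq_sum_range (fun l => a (n + 1 - l) * starInvC a l) (n+1)]
    simp [h]

theorem unit_comm {F G : PS} (h : F * G = 1) : G * F = 1 := by
  have hF : F ≠ 0 := by rintro rfl; simp at h
  apply mul_left_cancel₀ hF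
  rw [← mul_assoc, h]; simp

theorem mk_starInv' (a : ℕ → H) (h : a 0 ≠ 0) : mk (starInvC a) * (mk a : PS) = 1 :=
  unit_comm (mk_starInv a h)

theorem exists_inv (F : PS) (h : coeff 0 F ≠ 0) : ∃ G : PS, F * G = 1 ∧ G * F = 1 := by
  have h0 : (mk (fun m => coeff m F) : PS) = F := by ext1; simp
  refine ⟨mk (starInvC (fun m => coeff m F)), ?_, ?_⟩
  · have := mk_starInv (fun m => coeff m F) h
    rwa [h0] at this
  · have := mk_starInv' (fun m => coeff m F) h
    rwa [h0] at this

theorem mk_den (p : H) : (mk (oneMinusQPbarC p) : PS) = den p := by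
  ext1 n
  rcases n with _ | _ | n <;> simp [oneMinusQPbarC, den, coeff_X, coeff_one]
theorem mk_lin (p : H) : (mk (qMinusPC p) : PS) = lin p := by
  ext1 n
  rcases n with _ | _ | n <;> simp [qMinusPC, lin, coeff_X]

theorem den_mobius (p : H) : den p * mk (mobiusC p) = lin p := by
  rw [mobiusC, mk_starMul, ← mul_assoc, mk_lin, ← mk_den, mk_starInv _ (by simp [oneMinusQPbarC]), one_mul]

theorem mobius_den (p : H) : mk (mobiusC p) * den p = lin p := by
  apply mul_left_cancel₀ (den_ne p)
  rw [← mul_assoc, den_mobius, lin_den]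

theorem mk_one_ite : (mk (fun m => if m = 0 then (1:H) else 0) : PS) = 1 := by
  ext1 n; simp [coeff_one]

theorem isBlaschke_one (a : ℕ → H) : IsBlaschke a 1 ↔ IsMob (mk a) := by
  constructor
  · rintro ⟨ts, u, hl, ht, hu, rfl⟩
    obtain ⟨t, rfl⟩ := List.length_eq_one_iff.mp hl
    refine ⟨t, u, ht t (by simp), hu, ?_⟩
    have : (mk fun m => blaschkeListC [t] m * u : PS) = mk (blaschkeListC [t]) * C u := by
      ext1; simp
    rw [this, blaschkeListC, mk_starMul, blaschkeListC, mk_one_ite, mul_one, ← mul_assoc, den_mobius]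
  · rintro ⟨t, u, ht, hu, h⟩
    refine ⟨[t], u, rfl, by simpa using ht, hu, ?_⟩
    have h2 : (mk a : PS) = mk fun m => blaschkeListC [t] m * u := by
      apply mul_left_cancel₀ (den_ne t)
      have : (mk fun m => blaschkeListC [t] m * u : PS) = mk (blaschkeListC [t]) * C u := by
        ext1; simp
      rw [this, blaschkeListC, mk_starMul, blaschkeListC, mk_one_ite, mul_one, ← mul_assoc, den_mobius, h]
    funext m
    have := congrArg (coeff m) h2
    simpa using this

theorem isBlaschke_two (a : ℕ → H) : IsBlaschke a 2 ↔
    ∃ t g, ‖t‖ < 1 ∧ IsMob g ∧ den t * mk a = lin t * g := by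
  constructor
  · rintro ⟨ts, u, hl, ht, hu, rfl⟩
    obtain ⟨t, t', rfl⟩ := List.length_eq_two.mp hl
    refine ⟨t, mk (mobiusC t') * C u, ht t (by simp), ⟨t', u, ht t' (by simp), hu, ?_⟩, ?_⟩
    · rw [← mul_assoc, den_mobius]
    have : (mk fun m => blaschkeListC [t, t'] m * u : PS) = mk (blaschkeListC [t, t']) * C u := by
      ext1; simp
    rw [this, blaschkeListC, mk_starMul, blaschkeListC, mk_starMul, blaschkeListC, mk_one_ite, mul_one, ← mul_assoc, ← mul_assoc, den_mobius, mul_assoc]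
  · rintro ⟨t, g, ht, ⟨t', u, ht', hu, h'⟩, h⟩
    refine ⟨[t, t'], u, rfl, by simpa using ⟨ht, ht'⟩, hu, ?_⟩
    have h2 : (mk a : PS) = mk fun m => blaschkeListC [t, t'] m * u := by
      apply mul_left_cancel₀ (den_ne t)
      have : (mk fun m => blaschkeListC [t, t'] m * u : PS) = mk (blaschkeListC [t, t']) * C u := by
        ext1; simp
      rw [this, blaschkeListC, mk_starMul, blaschkeListC, mk_starMul, blaschkeListC, mk_one_ite, mul_one, ← mul_assoc, ← mul_assoc, den_mobius, h, mul_assoc]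
      congr 1
      apply mul_left_cancel₀ (den_ne t')
      rw [h', ← mul_assoc, den_mobius]
    funext m
    have := congrArg (coeff m) h2
    simpa using this

/-- key norm identity -/
theorem key_id (w x y : H) : ‖x - w * y‖ ^ 2 - ‖y - star w * x‖ ^ 2
    = (1 - ‖w‖ ^ 2) * (‖x‖ ^ 2 - ‖y‖ ^ 2) := by
  simp only [sq, ← Quaternion.normSq_eq_norm_mul_self, Quaternion.normSq_def']
  simp
  ring

theorem norm_one_sub_comm (x y : H) : ‖1 - x * y‖ = ‖1 - y * x‖ := by
  rcases eq_or_ne x 0 with rfl | hx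
  · simp
  · have : 1 - x * y = x * (1 - y * x) * x⁻¹ := by
      rw [mul_sub, sub_mul, mul_one, mul_inv_cancel₀ hx, ← mul_assoc, mul_assoc (x * y), mul_inv_cancel₀ hx, mul_one]
    rw [this, norm_mul, norm_mul, norm_inv]
    have : ‖x‖ ≠ 0 := by simpa using hx
    field_simp

theorem one_sub_ne {x : H} (h : ‖x‖ < 1) : 1 - x ≠ 0 := by
  intro h'
  have : x = 1 := (sub_eq_zero.mp h').symm
  rw [this] at h; simp at h



theorem NN_nonneg (n : ℕ) (F : PS) : 0 ≤ NN n F := Finset.sum_nonneg fun _ _ => by positivity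
theorem NN_mono {n m : ℕ} (h : n ≤ m) (F : PS) : NN n F ≤ NN m F :=
  Finset.sum_le_sum_of_subset_of_nonneg (Finset.range_mono h) fun _ _ _ => by positivity
theorem NN_congr {n : ℕ} {F G : PS} (h : ∀ m < n, coeff m F = coeff m G) : NN n F = NN n G :=
  Finset.sum_congr rfl fun m hm => by rw [h m (Finset.mem_range.mp hm)]

def tr (n : ℕ) (k : PS) : PS := mk fun m => if m < n then coeff m k else 0

theorem NN_mul_tr (n : ℕ) (F k : PS) : NN n (F * tr n k) = NN n (F * k) := by
  apply NN_congr
  intro m hm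
  rw [coeff_mul, coeff_mul]
  apply Finset.sum_congr rfl
  rintro ⟨i, j⟩ hij
  have := Finset.HasAntidiagonal.mem_antidiagonal.mp hij
  simp only at this
  have : j < n := by omega
  simp [tr, this]

theorem NN_tr {n M : ℕ} (h : n ≤ M) (k : PS) : NN M (tr n k) = NN n k := by
  rw [NN, NN, ← Finset.sum_subset (Finset.range_mono h)]
  · apply Finset.sum_congr rfl
    intro m hm
    simp [tr, Finset.mem_range.mp hm]
  · intro m _ hm
    simp at hm
    simp [tr, hm]

theorem coeff_den_zero (p : H) (j : PS) : coeff 0 (den p * j) = coeff 0 j := by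
  simp [den, sub_mul, mul_assoc]
theorem coeff_den_succ (p : H) (j : PS) (m : ℕ) :
    coeff (m + 1) (den p * j) = coeff (m + 1) j - star p * coeff m j := by
  simp [den, sub_mul, mul_assoc, coeff_succ_X_mul, coeff_C_mul]
theorem coeff_lin_zero (p : H) (j : PS) : coeff 0 (lin p * j) = -(p * coeff 0 j) := by
  simp [lin, sub_mul]
theorem coeff_lin_succ (p : H) (j : PS) (m : ℕ) :
    coeff (m + 1) (lin p * j) = coeff m j - p * coeff (m + 1) j := by
  simp [lin, sub_mul, coeff_succ_X_mul, coeff_C_mul]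

theorem NN_den (p : H) (j : PS) (n : ℕ) : NN (n + 1) (den p * j) =
    NN (n + 1) (lin p * j) + (1 - ‖p‖ ^ 2) * ‖coeff n j‖ ^ 2 := by
  induction n with
  | zero =>
    simp only [NN, zero_add, Finset.sum_range_one, coeff_den_zero, coeff_lin_zero, norm_neg, norm_mul]
    ring
  | succ n ih =>
    rw [NN, Finset.sum_range_succ, ← NN, ih, NN, NN, Finset.sum_range_succ _ (n + 1), coeff_den_succ, coeff_lin_succ]
    linarith [key_id p (coeff n j) (coeff (n + 1) j)]

def SA (F : PS) (r : ℝ) : Prop := Summable fun m => ‖coeff m F‖ * r ^ m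

def Bdd (F : PS) : Prop := ∃ c, ∀ m, ‖coeff m F‖ ≤ c

theorem Bdd.sa {F : PS} (h : Bdd F) {r : ℝ} (h0 : 0 ≤ r) (h1 : r < 1) : SA F r := by
  obtain ⟨c, hc⟩ := h
  refine Summable.of_nonneg_of_le (fun m => by positivity) (fun m => ?_)
    ((summable_geometric_of_lt_one h0 h1).mul_left c)
  exact mul_le_mul_of_nonneg_right (hc m) (by positivity)

theorem SA.summable {F : PS} {q : H} (h : SA F ‖q‖) : Summable fun m => q ^ m * coeff m F := by
  apply Summable.of_norm
  refine Summable.congr h fun m => ?_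
  rw [norm_mul, norm_pow, mul_comm]

theorem cauchy2 (f : ℕ × ℕ → H) (hf : Summable f) :
    ∑' n, ∑ ij ∈ Finset.HasAntidiagonal.antidiagonal n, f ij = ∑' j, ∑' i, f (i, j) := by
  have h1 : ∑' x : ℕ × ℕ, f x.swap = ∑' j, ∑' i, f (i, j) := (Summable.prod_symm hf).tsum_prod
  have h2 : ∑' x : ℕ × ℕ, f x.swap = ∑' x, f x := (Equiv.prodComm ℕ ℕ).tsum_eq f
  rw [← h1, h2,
    ← (Finset.HasAntidiagonal.sigmaAntidiagonalEquivProd (A := ℕ)).tsum_eq f]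
  refine Eq.trans ?_ (Summable.tsum_sigma' (fun n => (hasSum_fintype _).summable)
    ((Finset.HasAntidiagonal.sigmaAntidiagonalEquivProd (A := ℕ)).summable_iff.mpr hf)).symm
  congr 1
  funext n
  rw [tsum_fintype, ← Finset.sum_coe_sort]
  rfl

theorem ev_mul {F G : PS} {q : H} (hF : SA F ‖q‖) (hG : SA G ‖q‖) :
    ev (F * G) q = ∑' l, q ^ l * ev F q * coeff l G := by
  have hs : Summable fun ij : ℕ × ℕ => q ^ (ij.1 + ij.2) * (coeff ij.1 F * coeff ij.2 G) := by
    apply Summable.of_norm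
    have := Summable.mul_of_nonneg hF hG (fun m => by positivity) (fun m => by positivity)
    refine Summable.congr this fun ij => ?_
    rw [norm_mul, norm_mul, norm_pow, pow_add]; ring
  have h1 := cauchy2 _ hs
  rw [ev, evalC]
  have : ∀ m, q ^ m * coeff m (F * G) = ∑ ij ∈ Finset.HasAntidiagonal.antidiagonal m, q ^ (ij.1 + ij.2) * (coeff ij.1 F * coeff ij.2 G) := by
    intro m
    rw [coeff_mul, Finset.mul_sum]
    apply Finset.sum_congr rfl
    intro ij hij
    rw [Finset.HasAntidiagonal.mem_antidiagonal.mp hij]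
  simp_rw [this]
  rw [h1]
  congr 1
  funext l
  rw [ev, evalC, ← hF.summable.tsum_mul_left, ← Summable.tsum_mul_right]
  · congr 1; funext m
    rw [add_comm, pow_add]; simp only [mul_assoc]
  · exact hF.summable.mul_left _



theorem SA.add {F G : PS} {r : ℝ} (hr : 0 ≤ r) (hF : SA F r) (hG : SA G r) : SA (F + G) r := by
  refine Summable.of_nonneg_of_le (fun m => by positivity) (fun m => ?_) (Summable.add hF hG)
  rw [← add_mul, map_add]
  exact mul_le_mul_of_nonneg_right (norm_add_le _ _) (by positivity)
theorem SA.sub {F G : PS} {r : ℝ} (hr : 0 ≤ r) (hF : SA F r) (hG : SA G r) : SA (F - G) r := by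
  refine Summable.of_nonneg_of_le (fun m => by positivity) (fun m => ?_) (Summable.add hF hG)
  rw [← add_mul, map_sub]
  exact mul_le_mul_of_nonneg_right (norm_sub_le _ _) (by positivity)
theorem SA.C (w : H) (r : ℝ) : SA (C w) r := by
  apply summable_of_ne_finset_zero (s := {0})
  intro m hm
  simp at hm
  simp [coeff_C, hm]
theorem SA.X (r : ℝ) : SA X r := by
  apply summable_of_ne_finset_zero (s := {1})
  intro m hm
  simp at hm
  simp [coeff_X, hm]
theorem SA.one (r : ℝ) : SA 1 r := by
  have := SA.C 1 r
  simpa using this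
theorem SA.mul {F G : PS} {r : ℝ} (hr : 0 ≤ r) (hF : SA F r) (hG : SA G r) : SA (F * G) r := by
  have h := summable_norm_sum_mul_antidiagonal_of_summable_norm (R := H)
    (f := fun i => r ^ i • coeff i F) (g := fun i => r ^ i • coeff i G)
    (Summable.congr hF fun m => by rw [norm_smul, norm_pow, Real.norm_of_nonneg hr, mul_comm])
    (Summable.congr hG fun m => by rw [norm_smul, norm_pow, Real.norm_of_nonneg hr, mul_comm])
  refine Summable.congr h fun n => ?_
  have : ∑ kl ∈ Finset.HasAntidiagonal.antidiagonal n, (r ^ kl.1 • coeff kl.1 F) * (r ^ kl.2 • coeff kl.2 G)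
      = r ^ n • coeff n (F * G) := by
    rw [coeff_mul, Finset.smul_sum]
    apply Finset.sum_congr rfl
    intro ij hij
    rw [smul_mul_smul_comm, ← pow_add, Finset.HasAntidiagonal.mem_antidiagonal.mp hij]
  rw [this, norm_smul, norm_pow, Real.norm_of_nonneg hr, mul_comm]
theorem SA.lin (p : H) {r : ℝ} (hr : 0 ≤ r) : SA (lin p) r := (SA.X r).sub hr (SA.C p r)
theorem SA.den (p : H) {r : ℝ} (hr : 0 ≤ r) : SA (den p) r :=
  (SA.one r).sub hr ((SA.X r).mul hr (SA.C _ r))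

theorem ev_add {F G : PS} {q : H} (hF : SA F ‖q‖) (hG : SA G ‖q‖) : ev (F + G) q = ev F q + ev G q := by
  simp only [ev, evalC, map_add, mul_add]
  exact hF.summable.tsum_add hG.summable
theorem ev_sub {F G : PS} {q : H} (hF : SA F ‖q‖) (hG : SA G ‖q‖) : ev (F - G) q = ev F q - ev G q := by
  simp only [ev, evalC, map_sub, mul_sub]
  exact hF.summable.tsum_sub hG.summable
theorem ev_C (w q : H) : ev (C w) q = w := by
  rw [ev, evalC, tsum_eq_single 0]
  · simp
  · intro m hm; simp [coeff_C, hm]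
theorem ev_one (q : H) : ev 1 q = 1 := by
  have := ev_C 1 q; simpa using this
theorem ev_X (q : H) : ev X q = q := by
  rw [ev, evalC, tsum_eq_single 1]
  · simp
  · intro m hm; simp [coeff_X, hm]
theorem ev_lin (p q : H) : ev (lin p) q = q - p := by
  rw [lin, ev_sub (SA.X _) (SA.C _ _), ev_X, ev_C]
theorem ev_mul_C {F : PS} {q : H} (hF : SA F ‖q‖) (c : H) : ev (F * C c) q = ev F q * c := by
  rw [ev_mul hF (SA.C _ _), tsum_eq_single 0]
  · simp
  · intro m hm; simp [coeff_C, hm]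
theorem ev_X_mul {G : PS} {q : H} (hG : SA G ‖q‖) : ev (X * G) q = q * ev G q := by
  rw [ev_mul (SA.X _) hG, ev_X, ev, evalC, ← hG.summable.tsum_mul_left]
  congr 1; funext m
  rw [← pow_succ, pow_succ', mul_assoc]
theorem ev_real {F G : PS} {q : H} {x : ℝ} (hF : SA F ‖q‖) (hG : SA G ‖q‖) (h : ev F q = (x : H)) :
    ev (F * G) q = x * ev G q := by
  rw [ev_mul hF hG, h, ev, evalC, ← hG.summable.tsum_mul_left]
  congr 1; funext m
  rw [← Quaternion.coe_commutes, mul_assoc]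
theorem ev_zero_mul {F G : PS} {q : H} (hF : SA F ‖q‖) (hG : SA G ‖q‖) (h : ev F q = 0) :
    ev (F * G) q = 0 := by
  have := ev_real (x := 0) hF hG (by simpa using h)
  simpa using this
theorem ev_conj {F G : PS} {q : H} (hF : SA F ‖q‖) (hG : SA G ‖q‖) (h : ev F q ≠ 0) :
    ev (F * G) q = ev F q * ev G ((ev F q)⁻¹ * q * ev F q) := by
  have hn : ‖(ev F q)⁻¹ * q * ev F q‖ = ‖q‖ := by
    rw [norm_mul, norm_mul, norm_inv]
    have := norm_ne_zero_iff.mpr h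
    field_simp
  set y := ev F q with hy
  have hG' : SA G ‖y⁻¹ * q * y‖ := by rw [hn]; exact hG
  rw [ev_mul hF hG, ← hy, ev, evalC, ← hG'.summable.tsum_mul_left]
  congr 1; funext m
  have : (y⁻¹ * q * y) ^ m = y⁻¹ * q ^ m * y := by
    have hc := (SemiconjBy.eq (x := y⁻¹ * q * y) (a := y) (y := q) (by
      rw [SemiconjBy]; simp only [← mul_assoc]; rw [mul_inv_cancel₀ h, one_mul]) : _)
    have h2 : SemiconjBy y (y⁻¹ * q * y) q := hc
    have h3 := (h2.pow_right m).eq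
    calc _ = y⁻¹ * (y * (y⁻¹ * q * y) ^ m) := by rw [inv_mul_cancel_left₀ h]
      _ = _ := by rw [h3, mul_assoc]
  rw [this]
  simp only [← mul_assoc]; rw [mul_inv_cancel₀ h, one_mul]

theorem NN_one (n : ℕ) : NN (n + 1) 1 = 1 := by
  rw [NN, Finset.sum_eq_single 0]
  · simp
  · intro m _ hm; simp [coeff_one, hm]
  · simp
theorem Schur.NN_le {F : PS} (h : Schur F) (n : ℕ) : NN n F ≤ 1 := by
  refine (NN_mono (Nat.le_succ n) F).trans ?_
  have := h (n + 1) 1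
  rwa [mul_one, NN_one] at this
theorem le_NN (F : PS) (m : ℕ) : ‖coeff m F‖ ^ 2 ≤ NN (m + 1) F := by
  rw [NN, Finset.sum_range_succ]; linarith [NN_nonneg m F, show NN m F = ∑ x ∈ Finset.range m, ‖coeff x F‖ ^ 2 from rfl]
theorem Schur.coeff_le {F : PS} (h : Schur F) (m : ℕ) : ‖coeff m F‖ ≤ 1 := by
  have := (le_NN F m).trans (h.NN_le _)
  nlinarith [norm_nonneg (coeff m F)]
theorem Schur.bdd {F : PS} (h : Schur F) : Bdd F := ⟨1, h.coeff_le⟩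
theorem Schur.sa {F : PS} (h : Schur F) {q : H} (hq : ‖q‖ < 1) : SA F ‖q‖ := h.bdd.sa (norm_nonneg _) hq
theorem summable_of_NN {F : PS} {c : ℝ} (h : ∀ n, NN n F ≤ c) : Summable fun m => ‖coeff m F‖ ^ 2 :=
  summable_of_sum_range_le (fun _ => by positivity) h
theorem coeff_tendsto {F : PS} {c : ℝ} (h : ∀ n, NN n F ≤ c) :
    Filter.Tendsto (fun m => coeff m F) Filter.atTop (nhds 0) := by
  have h1 := (summable_of_NN h).tendsto_atTop_zero
  rw [tendsto_zero_iff_norm_tendsto_zero]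
  have := h1.sqrt
  simpa using this
theorem Schur.mul {F G : PS} (hF : Schur F) (hG : Schur G) : Schur (F * G) := fun n k => by
  rw [mul_assoc]; exact (hF n _).trans (hG n k)
theorem Schur.C {w : H} (h : ‖w‖ ≤ 1) : Schur (C w) := fun n k => by
  apply Finset.sum_le_sum
  intro m _
  rw [coeff_C_mul, norm_mul, mul_pow]
  have : ‖w‖ ^ 2 ≤ 1 := by nlinarith [norm_nonneg w]
  nlinarith [sq_nonneg ‖coeff m k‖]

theorem lin_diffQuot {F : PS} (hF : Bdd F) {p : H} (hp : ‖p‖ < 1) :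
    lin p * mk (diffQuotC (fun m => coeff m F) p) = F - C (ev F p) := by
  have key : ∀ m, Summable fun k => p ^ k * coeff (k + m) F := by
    intro m
    obtain ⟨c, hc⟩ := hF
    apply Summable.of_norm
    refine Summable.of_nonneg_of_le (fun m => by positivity) (fun k => ?_)
      ((summable_geometric_of_lt_one (norm_nonneg p) hp).mul_right c)
    rw [norm_mul, norm_pow]
    exact mul_le_mul_of_nonneg_left (hc _) (by positivity)
  have hrec : ∀ m, p * ∑' k, p ^ k * coeff (k + m + 1) F = (∑' k, p ^ k * coeff (k + m) F) - coeff m F := by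
    intro m
    rw [← Summable.tsum_mul_left, (key m).tsum_eq_zero_add]
    · simp only [pow_zero, one_mul, zero_add, add_sub_cancel_left]
      congr 1; funext k
      rw [pow_succ', mul_assoc, show k + 1 + m = k + m + 1 by omega]
    · exact key (m + 1)
  ext1 m
  cases m with
  | zero =>
    rw [coeff_lin_zero, coeff_mk, diffQuotC, hrec 0]
    simp [ev, evalC]
  | succ m =>
    rw [coeff_lin_succ, coeff_mk, coeff_mk, diffQuotC, diffQuotC, hrec (m + 1)]
    simp only [map_sub, coeff_C, add_assoc]
    simp

theorem diffQuot_tendsto {F : PS} (hF : Bdd F) (h0 : Filter.Tendsto (fun m => coeff m F) Filter.atTop (nhds 0))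
    {p : H} (hp : ‖p‖ < 1) :
    Filter.Tendsto (diffQuotC (fun m => coeff m F) p) Filter.atTop (nhds 0) := by
  obtain ⟨c, hc⟩ := hF
  have := tendsto_tsum_of_dominated_convergence (𝓕 := Filter.atTop) (f := fun m k => p ^ k * coeff (k + m + 1) F)
    (g := fun _ => (0 : H)) (bound := fun k => ‖p‖ ^ k * c)
    ((summable_geometric_of_lt_one (norm_nonneg p) hp).mul_right c) ?_ ?_
  · simp only [tsum_zero] at this; exact this
  · intro k
    have h1 : Filter.Tendsto (fun m => coeff (k + m + 1) F) Filter.atTop (nhds 0) :=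
      h0.comp (Filter.tendsto_atTop_mono (fun m => by show m ≤ k + m + 1; omega) Filter.tendsto_id)
    simpa using h1.const_mul (p ^ k)
  · refine Filter.Eventually.of_forall fun m k => ?_
    rw [norm_mul, norm_pow]
    exact mul_le_mul_of_nonneg_left (hc _) (by positivity)



theorem unit_den {F : PS} (hF : Schur F) {w : H} (hw : ‖w‖ < 1) :
    ∃ G : PS, (1 - C (star w) * F) * G = 1 ∧ G * (1 - C (star w) * F) = 1 := by
  apply exists_inv
  simp only [map_sub, coeff_C_mul, coeff_one, if_true]
  apply one_sub_ne
  rw [norm_mul, norm_star]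
  nlinarith [hF.coeff_le 0, norm_nonneg (coeff 0 F), norm_nonneg w]
theorem unit_den' {F : PS} (hF : Schur F) {w : H} (hw : ‖w‖ < 1) :
    ∃ G : PS, (1 - F * C (star w)) * G = 1 ∧ G * (1 - F * C (star w)) = 1 := by
  apply exists_inv
  simp only [map_sub, coeff_mul_C, coeff_one, if_true]
  apply one_sub_ne
  rw [norm_mul, norm_star]
  nlinarith [hF.coeff_le 0, norm_nonneg (coeff 0 F), norm_nonneg w]

theorem C_coe_comm (x : ℝ) (F : PS) : (C (x : H) : PS) * F = F * C (x : H) := by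
  ext1 m
  rw [coeff_C_mul, coeff_mul_C, Quaternion.coe_commutes]
theorem one_sub_swap (F : PS) (w : H) :
    (F - C w) * (1 - C (star w) * F) = (1 - F * C (star w)) * (F - C w) := by
  have h1 : (C w : PS) * (C (star w) * F) = F * (C (star w) * C w) := by
    rw [← mul_assoc, ← map_mul, ← map_mul, sq_star, star_sq, C_coe_comm]
  simp only [mul_sub, sub_mul, mul_one, one_mul, mul_assoc, h1]
  abel
theorem swap {F F' : PS} (hF : Schur F) {w : H} (hw : ‖w‖ < 1)
    (h : F' * (1 - C (star w) * F) = F - C w) : (1 - F * C (star w)) * F' = F - C w := by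
  obtain ⟨G, h1, h2⟩ := unit_den hF hw
  have h0 : (1 - C (star w) * F) ≠ 0 := by intro h; rw [h] at h1; simp at h1
  apply mul_right_cancel₀ h0
  rw [mul_assoc, h, one_sub_swap]
theorem swap' {F F' : PS} (hF : Schur F) {w : H} (hw : ‖w‖ < 1)
    (h : (1 - F * C (star w)) * F' = F - C w) : F' * (1 - C (star w) * F) = F - C w := by
  obtain ⟨G, h1, h2⟩ := unit_den' hF hw
  have h0 : (1 - F * C (star w)) ≠ 0 := by intro h; rw [h] at h1; simp at h1
  apply mul_left_cancel₀ h0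
  rw [← mul_assoc, h, one_sub_swap]

theorem NN_key (F k : PS) (w : H) (n : ℕ) : NN n ((F - C w) * k) - NN n ((1 - C (star w) * F) * k)
    = (1 - ‖w‖ ^ 2) * (NN n (F * k) - NN n k) := by
  simp only [NN, ← Finset.sum_sub_distrib, Finset.mul_sum]
  apply Finset.sum_congr rfl
  intro m _
  rw [← key_id]
  simp [sub_mul, mul_assoc, coeff_C_mul]

theorem Schur_mobius {F F' : PS} (hF : Schur F) {w : H} (hw : ‖w‖ < 1)
    (h : F' * (1 - C (star w) * F) = F - C w) : Schur F' := by
  intro n k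
  obtain ⟨G, h1, h2⟩ := unit_den hF hw
  have hk : k = (1 - C (star w) * F) * (G * k) := by rw [← mul_assoc, h1, one_mul]
  have hFk : F' * k = (F - C w) * (G * k) := by
    conv_lhs => rw [hk]
    rw [← mul_assoc, h]
  have := NN_key F (G * k) w n
  rw [← hk, ← hFk] at this
  have h3 := hF n (G * k)
  have : 0 ≤ 1 - ‖w‖ ^ 2 := by nlinarith [norm_nonneg w]
  nlinarith

theorem coeff_mul_tr_tendsto {R : PS} (hR : Filter.Tendsto (fun m => coeff m R) Filter.atTop (nhds 0))
    (n : ℕ) (k : PS) : Filter.Tendsto (fun m => coeff m (R * tr n k)) Filter.atTop (nhds 0) := by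
  have h1 : Filter.Tendsto (fun m => ∑ l ∈ Finset.range n, coeff (m - l) R * coeff l k) Filter.atTop
      (nhds (∑ l ∈ Finset.range n, 0 * coeff l k)) := by
    apply tendsto_finsetSum
    intro l _
    apply Filter.Tendsto.mul_const
    exact hR.comp (Filter.tendsto_sub_atTop_nat l)
  simp only [zero_mul, Finset.sum_const_zero] at h1
  refine h1.congr' ?_
  filter_upwards [Filter.eventually_ge_atTop n] with m hm
  rw [coeff_mul, ← Finset.Nat.sum_antidiagonal_swap, Finset.Nat.sum_antidiagonal_eq_sum_range_succ_mk,
    ← Finset.sum_subset (Finset.range_mono (show n ≤ m.succ by omega))]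
  · apply Finset.sum_congr rfl
    intro l hl
    simp [tr, Finset.mem_range.mp hl]
  · intro l _ hl
    simp at hl
    simp [tr, hl]

theorem Schur_div {F' g : PS} (hF : Schur F') {p : H} (hp : ‖p‖ < 1) (h0 : ev F' p = 0)
    (h : lin p * g = den p * F') : Schur g := by
  set R : PS := mk (diffQuotC (fun m => coeff m F') p) with hRdef
  have hR : lin p * R = F' := by rw [lin_diffQuot hF.bdd hp, h0]; simp
  have hRt : Filter.Tendsto (fun m => coeff m R) Filter.atTop (nhds 0) := by
    simp only [hRdef, coeff_mk]
    exact diffQuot_tendsto hF.bdd (coeff_tendsto hF.NN_le) hp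
  have hg : g = den p * R := by
    apply mul_left_cancel₀ (lin_ne p)
    rw [h, ← mul_assoc, lin_den, mul_assoc, hR]
  intro n k
  rw [← NN_mul_tr]
  have h1 := coeff_mul_tr_tendsto hRt n k
  have h2 : Filter.Tendsto (fun m => NN n k + (1 - ‖p‖ ^ 2) * ‖coeff m (R * tr n k)‖ ^ 2) Filter.atTop
      (nhds (NN n k + (1 - ‖p‖ ^ 2) * ‖(0 : H)‖ ^ 2)) :=
    ((h1.norm.pow 2).const_mul _).const_add _
  simp only [norm_zero, ne_eq, OfNat.ofNat_ne_zero, not_false_eq_true, zero_pow, mul_zero, add_zero] at h2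
  refine ge_of_tendsto h2 ?_
  filter_upwards [Filter.eventually_ge_atTop n] with m hm
  calc NN n (g * tr n k) ≤ NN (m + 1) (g * tr n k) := NN_mono (by omega) _
    _ = NN (m + 1) (F' * tr n k) + (1 - ‖p‖ ^ 2) * ‖coeff m (R * tr n k)‖ ^ 2 := by
      rw [hg, mul_assoc, NN_den, ← mul_assoc, hR]
    _ ≤ _ := by
      have := hF (m + 1) (tr n k)
      rw [NN_tr (by omega)] at this
      linarith

theorem HD_unique {F : PS} (hF : Schur F) {p w : H} (hw : ‖w‖ < 1) {g g' : PS} (h : HD F p w g)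
    (h' : HD F p w g') : g = g' := by
  obtain ⟨G, h1, h2⟩ := unit_den hF hw
  have h0 : (1 - C (star w) * F) ≠ 0 := by intro h; rw [h] at h1; simp at h1
  exact mul_left_cancel₀ (lin_ne p) (mul_right_cancel₀ h0 (h.trans h'.symm))

/-- data: F' is the bullet -/
theorem HD_bullet {F : PS} (hF : Schur F) {p w : H} (hw : ‖w‖ < 1) {g : PS} (h : HD F p w g) :
    ∃ F' : PS, F' * (1 - C (star w) * F) = F - C w ∧ (1 - F * C (star w)) * F' = F - C w ∧
      lin p * g = den p * F' ∧ Schur F' := by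
  obtain ⟨G, h1, h2⟩ := unit_den hF hw
  have e : (F - C w) * G * (1 - C (star w) * F) = F - C w := by rw [mul_assoc, h2, mul_one]
  refine ⟨(F - C w) * G, e, swap hF hw e, ?_, Schur_mobius hF hw e⟩
  have h0 : (1 - C (star w) * F) ≠ 0 := by intro h; rw [h] at h1; simp at h1
  apply mul_right_cancel₀ h0
  rw [mul_assoc (den p), e]; exact h

theorem ev_oneSub {F : PS} (hF : Schur F) {p : H} (hp : ‖p‖ < 1) :
    ev (1 - F * C (star (ev F p))) p = ((1 - ‖ev F p‖ ^ 2 : ℝ) : H) := by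
  rw [ev_sub (SA.one _) ((hF.sa hp).mul (norm_nonneg _) (SA.C _ _)), ev_one, ev_mul_C (hF.sa hp), sq_star]
  simp

theorem sa_oneSub {F : PS} (hF : Schur F) {p : H} (hp : ‖p‖ < 1) (w : H) :
    SA (1 - F * C (star w)) ‖p‖ :=
  (SA.one _).sub (norm_nonneg _) ((hF.sa hp).mul (norm_nonneg _) (SA.C _ _))

theorem ev_bullet {F : PS} (hF : Schur F) {p : H} (hp : ‖p‖ < 1) (hw : ‖ev F p‖ < 1) {F' : PS}
    (hF' : Schur F') (h : (1 - F * C (star (ev F p))) * F' = F - C (ev F p)) : ev F' p = 0 := by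
  have h1 : ev ((1 - F * C (star (ev F p))) * F') p = ev (F - C (ev F p)) p := by rw [h]
  rw [ev_real (sa_oneSub hF hp _) (hF'.sa hp) (ev_oneSub hF hp), ev_sub (hF.sa hp) (SA.C _ _), ev_C, sub_self,
    mul_eq_zero] at h1
  rcases h1 with h1 | h1
  · have : (1 - ‖ev F p‖ ^ 2 : ℝ) = 0 := by
      have := congrArg (fun x : H => x.re) h1
      simpa only [Quaternion.re_coe, Quaternion.re_zero] using this
    nlinarith [norm_nonneg (ev F p)]
  · exact h1

theorem HD_schur {F : PS} (hF : Schur F) {p : H} (hp : ‖p‖ < 1) (hw : ‖ev F p‖ < 1) {g : PS}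
    (h : HD F p (ev F p) g) : Schur g := by
  obtain ⟨F', h1, h2, h3, h4⟩ := HD_bullet hF hw h
  exact Schur_div h4 hp (ev_bullet hF hp hw h4 h2) h3

theorem mk_coeff (F : PS) : (mk (fun m => coeff m F) : PS) = F := by ext1; simp
theorem hdq_HD {a : ℕ → H} (hF : Schur (mk a)) {p : H} (hp : ‖p‖ < 1) (hw : ‖evalC a p‖ < 1) :
    HD (mk a) p (evalC a p) (mk (hdqC a p)) := by
  have hev : ev (mk a) p = evalC a p := by simp [ev]
  have hm : (mk (fun m => (if m = 0 then (1 : H) else 0) - star (evalC a p) * a m) : PS)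
      = 1 - C (star (evalC a p)) * mk a := by
    ext1 m; simp [coeff_one, coeff_C_mul]
  have hu : mk (starInvC (fun m => (if m = 0 then (1 : H) else 0) - star (evalC a p) * a m))
      * (1 - C (star (evalC a p)) * mk a) = 1 := by
    rw [← hm]
    apply mk_starInv'
    apply one_sub_ne
    rw [norm_mul, norm_star]
    have := hF.coeff_le 0
    rw [coeff_mk] at this
    nlinarith [norm_nonneg (a 0), norm_nonneg (evalC a p)]
  have hd := lin_diffQuot hF.bdd hp
  simp only [coeff_mk, hev] at hd
  rw [HD, hdqC, mk_starMul, mk_starMul, mk_den, mul_assoc (lin p), mul_assoc, hu, mul_one, ← mul_assoc, lin_den,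
    mul_assoc, hd]

theorem bullet_eq {a : ℕ → H} (hF : Schur (mk a)) {w : H} (hw : ‖w‖ < 1) {F' : PS}
    (h : (1 - mk a * C (star w)) * F' = mk a - C w) : mk (bulletC w a) = F' := by
  have hm : (mk (fun m => (if m = 0 then (1 : H) else 0) - a m * star w) : PS)
      = 1 - mk a * C (star w) := by
    ext1 m; simp [coeff_one]
  have hm2 : (mk (fun m => a m - if m = 0 then w else 0) : PS) = mk a - C w := by
    ext1 m; simp [coeff_C]
  have hu : mk (starInvC (fun m => (if m = 0 then (1 : H) else 0) - a m * star w))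
      * (1 - mk a * C (star w)) = 1 := by
    rw [← hm]
    apply mk_starInv'
    apply one_sub_ne
    rw [norm_mul, norm_star]
    have := hF.coeff_le 0
    rw [coeff_mk] at this
    nlinarith [norm_nonneg (a 0), norm_nonneg w]
  rw [bulletC, mk_starMul, hm2, ← h, ← mul_assoc, hu, one_mul]



abbrev HS : Type := lp (fun _ : ℕ => H) 2

def ser (x : HS) : PS := mk fun m => x m
theorem coeff_ser (x : HS) (m : ℕ) : coeff m (ser x) = x m := coeff_mk _ _
theorem ser_inj {x y : HS} (h : ser x = ser y) : x = y := by
  ext1; funext m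
  rw [← coeff_ser, h, coeff_ser]
def ofPS (F : PS) (h : Summable fun m => ‖coeff m F‖ ^ 2) : HS :=
  ⟨fun m => coeff m F, by
    apply memℓp_gen
    simpa using h⟩
theorem ser_ofPS (F : PS) (h) : ser (ofPS F h) = F := by ext1 m; simp [ser, ofPS]
theorem ser_add (x y : HS) : ser (x + y) = ser x + ser y := by ext1 m; simp [ser]
theorem ser_sub (x y : HS) : ser (x - y) = ser x - ser y := by ext1 m; simp [ser]

theorem hasSum_norm (x : HS) : HasSum (fun m => ‖x m‖ ^ 2) (‖x‖ ^ 2) := by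
  have := lp.hasSum_norm (p := 2) (by norm_num) x
  simpa using this
theorem NN_ser_le (x : HS) (n : ℕ) : NN n (ser x) ≤ ‖x‖ ^ 2 := by
  have := sum_le_hasSum (Finset.range n) (fun _ _ => by positivity) (hasSum_norm x)
  simpa only [NN, coeff_ser] using this
theorem NN_tendsto (x : HS) : Filter.Tendsto (fun n => NN n (ser x)) Filter.atTop (nhds (‖x‖ ^ 2)) := by
  have := (hasSum_norm x).tendsto_sum_nat
  simpa only [NN, coeff_ser] using this
theorem summable_ser (x : HS) : Summable fun m => ‖coeff m (ser x)‖ ^ 2 := by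
  simpa only [coeff_ser] using (hasSum_norm x).summable
theorem ser_bdd (x : HS) : Bdd (ser x) := by
  refine ⟨‖x‖, fun m => ?_⟩
  have := (le_NN (ser x) m).trans (NN_ser_le x _)
  exact abs_le_of_sq_le_sq' this (norm_nonneg _) |>.2
theorem ser_sa (x : HS) {q : H} (hq : ‖q‖ < 1) : SA (ser x) ‖q‖ := (ser_bdd x).sa (norm_nonneg _) hq
theorem ser_tendsto (x : HS) : Filter.Tendsto (fun m => coeff m (ser x)) Filter.atTop (nhds 0) :=
  coeff_tendsto (NN_ser_le x)

theorem Schur.summable {F : PS} (hF : Schur F) (x : HS) : Summable fun m => ‖coeff m (F * ser x)‖ ^ 2 :=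
  summable_of_NN (c := ‖x‖ ^ 2) fun n => (hF n _).trans (NN_ser_le x n)

theorem ofPS_le (F : PS) (hF : Schur F) (x : HS) : ‖ofPS (F * ser x) (hF.summable x)‖ ≤ ‖x‖ := by
  refine (abs_le_of_sq_le_sq' ?_ (norm_nonneg _)).2
  refine le_of_tendsto_of_tendsto' (NN_tendsto _) (NN_tendsto x) fun n => ?_
  rw [ser_ofPS]; exact hF n _

def L (F : PS) (hF : Schur F) : HS →L[ℝ] HS :=
  LinearMap.mkContinuous
    { toFun := fun x => ofPS (F * ser x) (hF.summable x)
      map_add' := fun x y => by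
        apply ser_inj
        rw [ser_ofPS, ser_add x y, ser_add, ser_ofPS, ser_ofPS, mul_add]
      map_smul' := fun c x => by
        apply ser_inj
        rw [ser_ofPS]
        ext1 m
        simp only [ser, coeff_mul, coeff_mk, ofPS, lp.coeFn_smul, Pi.smul_apply, RingHom.id_apply, mul_smul_comm, Finset.smul_sum] } 1
    fun x => by
      simp only [LinearMap.coe_mk, AddHom.coe_mk, one_mul]
      exact ofPS_le F hF x
theorem ser_L (F : PS) (hF : Schur F) (x : HS) : ser (L F hF x) = F * ser x := ser_ofPS _ (hF.summable x)
theorem L_le (F : PS) (hF : Schur F) (x : HS) : ‖L F hF x‖ ≤ ‖x‖ := by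
  exact ofPS_le F hF x
theorem Ladj_le (F : PS) (hF : Schur F) (x : HS) : ‖(L F hF).adjoint x‖ ≤ ‖x‖ := by
  have h1 : ‖(L F hF).adjoint‖ ≤ 1 := by
    rw [LinearIsometryEquiv.norm_map]
    exact ContinuousLinearMap.opNorm_le_bound _ zero_le_one fun x => by simpa using L_le F hF x
  simpa using (L F hF).adjoint.le_of_opNorm_le h1 x

theorem inner_mul (a c x : H) : inner ℝ (star a * c) x = inner ℝ c (a * x) := by
  simp only [Quaternion.inner_def]
  simp
  ring
theorem inner_mul' (a c x : H) : inner ℝ (a * c) x = inner ℝ c (star a * x) := by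
  rw [← inner_mul, star_star]

def kerS (q c : H) : PS := mk fun m => star q ^ m * c
theorem kerS_summable {q : H} (hq : ‖q‖ < 1) (c : H) : Summable fun m => ‖coeff m (kerS q c)‖ ^ 2 := by
  have h1 : ‖q‖ ^ 2 < 1 := by nlinarith [norm_nonneg q]
  refine ((summable_geometric_of_lt_one (sq_nonneg _) h1).mul_right (‖c‖ ^ 2)).congr fun m => ?_
  simp only [kerS, coeff_mk, norm_mul, norm_pow, norm_star]
  ring
def ker (q c : H) (hq : ‖q‖ < 1) : HS := ofPS (kerS q c) (kerS_summable hq c)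
theorem ser_ker (q c : H) (hq : ‖q‖ < 1) : ser (ker q c hq) = kerS q c := ser_ofPS _ _
theorem ker_apply (q c : H) (hq : ‖q‖ < 1) (m : ℕ) : ker q c hq m = star q ^ m * c := by
  simp [ker, ofPS, kerS]
theorem inner_ker (q c : H) (hq : ‖q‖ < 1) (x : HS) : inner ℝ (ker q c hq) x = inner ℝ c (ev (ser x) q) := by
  rw [lp.inner_eq_tsum, ev, evalC]
  have h := (ser_sa x hq).summable
  rw [← innerSL_apply_apply ℝ c, ContinuousLinearMap.map_tsum _ h]
  congr 1; funext m
  rw [innerSL_apply_apply, ker_apply, ← star_pow, inner_mul, coeff_ser]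
theorem kerS_mul (q c : H) : kerS q c = kerS q 1 * C c := by
  ext1 m; simp [kerS]

theorem norm_ker (q c : H) (hq : ‖q‖ < 1) : ‖ker q c hq‖ ^ 2 = ‖c‖ ^ 2 * ∑' m, (‖q‖ ^ 2) ^ m := by
  rw [← (hasSum_norm _).tsum_eq, ← tsum_mul_left]
  congr 1; funext m
  rw [ker_apply, norm_mul, norm_pow, norm_star]; ring

theorem E_lemma {F : PS} (hF : Schur F) {q : H} (hq : ‖q‖ < 1) :
    ‖ev F q‖ ≤ 1 ∧ (‖ev F q‖ = 1 → F = C (ev F q)) := by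
  set v := ev F q with hv
  set K := ∑' m, (‖q‖ ^ 2) ^ m with hK
  have h1 : ‖q‖ ^ 2 < 1 := by nlinarith [norm_nonneg q]
  have hs := summable_geometric_of_lt_one (sq_nonneg ‖q‖) h1
  have hK1 : 0 < K := by
    rw [hK, tsum_geometric_of_lt_one (sq_nonneg _) h1]
    exact inv_pos.mpr (by linarith)
  have hCv : ∀ m, coeff m (C (star v) * kerS q 1) = star v * star q ^ m := by
    intro m; simp [kerS, coeff_C_mul]
  have hb : Summable fun m => ‖coeff m (C (star v) * kerS q 1)‖ ^ 2 := by
    refine (hs.mul_left (‖v‖ ^ 2)).congr fun m => ?_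
    rw [hCv, norm_mul, norm_pow, norm_star, norm_star]; ring
  set b := ofPS _ hb with hbd
  have hbn : ‖b‖ ^ 2 = ‖v‖ ^ 2 * K := by
    rw [← (hasSum_norm _).tsum_eq, hK, ← tsum_mul_left]
    congr 1; funext m
    rw [← coeff_ser, ser_ofPS, hCv, norm_mul, norm_pow, norm_star, norm_star]; ring
  have hbs : ser b = C (star v) * kerS q 1 := ser_ofPS _ _
  have hev : ev (ser (L F hF b)) q = ((‖v‖ ^ 2 * K : ℝ) : H) := by
    rw [ser_L, ev_mul (hF.sa hq) (ser_sa b hq), ← hv, hbs]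
    simp only [hCv]
    have : ∀ l, q ^ l * v * (star v * star q ^ l) = ((‖v‖ ^ 2 * (‖q‖ ^ 2) ^ l : ℝ) : H) := by
      intro l
      rw [mul_assoc, ← mul_assoc v, sq_star, Quaternion.coe_commutes, ← mul_assoc, ← star_pow, sq_star,
        ← Quaternion.coe_mul, norm_pow]
      congr 1; ring
    simp_rw [this]
    rw [← tsum_mul_left]
    exact (Quaternion.tsum_coe _)
  have hin : inner ℝ (ker q 1 hq) (L F hF b) = ‖v‖ ^ 2 * K := by
    rw [inner_ker, hev, Quaternion.inner_def, Quaternion.star_coe, one_mul, Quaternion.re_coe]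
  have hkn : ‖ker q 1 hq‖ ^ 2 = K := by rw [norm_ker]; simp [hK]
  have hLb : ‖L F hF b‖ ^ 2 ≤ ‖v‖ ^ 2 * K := by
    rw [← hbn]; exact pow_le_pow_left₀ (norm_nonneg _) (L_le F hF b) 2
  constructor
  · have h2 := norm_sub_sq_real (ker q 1 hq) (L F hF b)
    by_contra hc
    push Not at hc
    have h3 := sq_nonneg ‖ker q 1 hq - L F hF b‖
    rw [h2, hin, hkn] at h3
    have : 1 < ‖v‖ ^ 2 := by nlinarith
    nlinarith
  · intro hv1
    have h2 := norm_sub_sq_real (ker q 1 hq) (L F hF b)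
    rw [hin, hkn, hv1] at h2
    rw [hv1] at hLb
    have h3 : ‖ker q 1 hq - L F hF b‖ = 0 := by
      have := sq_nonneg ‖ker q 1 hq - L F hF b‖
      have h4 : ‖ker q 1 hq - L F hF b‖ ^ 2 = 0 := by linarith
      exact pow_eq_zero_iff two_ne_zero |>.mp h4
    have h4 : ker q 1 hq = L F hF b := sub_eq_zero.mp (norm_eq_zero.mp h3)
    have h5 := congrArg ser h4
    rw [ser_ker, ser_L, hbs, ← mul_assoc] at h5
    have hk0 : kerS q 1 ≠ 0 := by
      intro h; have := congrArg (coeff 0) h; simp [kerS] at this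
    have h6 : F * C (star v) = 1 := mul_right_cancel₀ hk0 (by rw [← h5, one_mul])
    calc F = F * C (star v * v) := by rw [star_sq, hv1]; simp
      _ = C v := by rw [map_mul, ← mul_assoc, h6, one_mul]



theorem Schur_X : Schur X := by
  intro n k
  cases n with
  | zero => simp [NN]
  | succ n =>
    rw [NN, Finset.sum_range_succ', ]
    simp only [coeff_succ_X_mul, coeff_zero_X_mul, norm_zero]
    simp only [ne_eq, OfNat.ofNat_ne_zero, not_false_eq_true, zero_pow, add_zero]
    exact NN_mono (Nat.le_succ n) k

abbrev Mo (p : H) : PS := mk (mobiusC p)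
theorem Schur_Mo {p : H} (hp : ‖p‖ < 1) : Schur (Mo p) := by
  apply Schur_mobius Schur_X hp
  rw [CX]; exact mobius_den p

theorem ev_mul_oneSub {F : PS} {q : H} (hF : SA F ‖q‖) (τ : H) :
    ev (F * (1 - X * C τ)) q = ev F q - q * ev F q * τ := by
  have h1 : SA (F * C τ) ‖q‖ := hF.mul (norm_nonneg _) (SA.C _ _)
  rw [mul_sub, mul_one, FX', ev_sub hF ((SA.X _).mul (norm_nonneg _) h1), ev_X_mul h1, ev_mul_C hF, mul_assoc]

theorem fix_zero {q y τ : H} (hq : ‖q‖ < 1) (hτ : ‖τ‖ ≤ 1) (h : y - q * y * τ = 0) : y = 0 := by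
  have h1 : ‖y‖ = ‖q‖ * ‖y‖ * ‖τ‖ := by rw [← norm_mul, ← norm_mul, ← sub_eq_zero.mp h]
  by_contra hy
  have := norm_pos_iff.mpr hy
  have h2 : ‖q‖ * ‖τ‖ < 1 := by nlinarith [norm_nonneg q, norm_nonneg τ]
  nlinarith

theorem ev_Mo {p : H} (hp : ‖p‖ < 1) : ev (Mo p) p = 0 := by
  have h := ev_mul_oneSub ((Schur_Mo hp).sa hp) (star p)
  have h2 : Mo p * (1 - X * C (star p)) = lin p := mobius_den p
  rw [h2, ev_lin, sub_self] at h
  exact fix_zero hp (by rw [norm_star]; exact hp.le) h.symm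

theorem eq_Mo_mul {p : H} {F g : PS} (h : lin p * g = den p * F) : F = Mo p * g := by
  apply mul_left_cancel₀ (den_ne p)
  rw [← h, ← mul_assoc, den_mobius]

theorem HS_ext {x y : HS} (h : ∀ z : HS, inner ℝ x z = inner ℝ y z) : x = y := ext_inner_right ℝ h

theorem Mo_isom {p : H} (hp : ‖p‖ < 1) (h : HS) (h0 : ev (ser h) p = 0) :
    ‖(L (Mo p) (Schur_Mo hp)).adjoint h‖ = ‖h‖ := by
  set R : PS := mk (diffQuotC (fun m => coeff m (ser h)) p) with hRdef
  have hR : lin p * R = ser h := by rw [lin_diffQuot (ser_bdd h) hp, h0]; simp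
  have hRt : Filter.Tendsto (fun m => coeff m R) Filter.atTop (nhds 0) := by
    simp only [hRdef, coeff_mk]
    exact diffQuot_tendsto (ser_bdd h) (ser_tendsto h) hp
  have hRb : ∃ c, ∀ m, ‖coeff m R‖ ^ 2 ≤ c := by
    obtain ⟨c, hc⟩ := (hRt.norm.pow 2).bddAbove_range
    exact ⟨c, fun m => hc ⟨m, rfl⟩⟩
  obtain ⟨c, hc⟩ := hRb
  have hpos : 0 ≤ 1 - ‖p‖ ^ 2 := by nlinarith [norm_nonneg p]
  have hsum : Summable fun m => ‖coeff m (den p * R)‖ ^ 2 := by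
    apply summable_of_NN (c := ‖h‖ ^ 2 + (1 - ‖p‖ ^ 2) * c)
    intro n
    refine (NN_mono (Nat.le_succ n) _).trans ?_
    rw [NN_den, hR]
    exact add_le_add (NN_ser_le h _) (mul_le_mul_of_nonneg_left (hc _) hpos)
  set y := ofPS _ hsum with hy
  have hys : ser y = den p * R := ser_ofPS _ _
  have hyn : ‖y‖ ^ 2 = ‖h‖ ^ 2 := by
    have t1 := (NN_tendsto y).comp (Filter.tendsto_add_atTop_nat 1)
    have t2 := ((NN_tendsto h).comp (Filter.tendsto_add_atTop_nat 1)).add ((hRt.norm.pow 2).const_mul (1 - ‖p‖ ^ 2))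
    simp only [norm_zero, ne_eq, OfNat.ofNat_ne_zero, not_false_eq_true, zero_pow, mul_zero, add_zero] at t2
    refine tendsto_nhds_unique t1 (t2.congr fun n => ?_)
    simp only [Function.comp]
    rw [hys, NN_den, hR]
  have hyn' : ‖y‖ = ‖h‖ := by
    have := (sq_eq_sq₀ (norm_nonneg y) (norm_nonneg h)).mp hyn
    exact this
  have hL : L (Mo p) (Schur_Mo hp) y = h := by
    apply ser_inj
    rw [ser_L, hys, ← mul_assoc, mobius_den, hR]
  apply le_antisymm (Ladj_le _ _ _)
  have h1 : inner ℝ ((L (Mo p) (Schur_Mo hp)).adjoint h) y = ‖h‖ ^ 2 := by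
    rw [ContinuousLinearMap.adjoint_inner_left, hL, real_inner_self_eq_norm_sq]
  have h2 := real_inner_le_norm ((L (Mo p) (Schur_Mo hp)).adjoint h) y
  rw [h1, hyn'] at h2
  rcases (norm_nonneg h).eq_or_lt with h3 | h3
  · rw [← h3]; exact norm_nonneg _
  · nlinarith

/-- `h - w · F† h` -/
def HB (F : PS) (hF : Schur F) (w : H) (hw : ‖w‖ < 1) : HS →L[ℝ] HS :=
  ContinuousLinearMap.id ℝ HS - (L (C w) (Schur.C hw.le)).comp (L F hF).adjoint

theorem LC_apply {w : H} (hw : Schur (C w)) (x : HS) (m : ℕ) : (L (C w) hw x) m = w * x m := by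
  rw [← coeff_ser, ser_L, coeff_C_mul, coeff_ser]
theorem HB_apply (F : PS) (hF : Schur F) (w : H) (hw : ‖w‖ < 1) (h : HS) :
    HB F hF w hw h = h - L (C w) (Schur.C hw.le) ((L F hF).adjoint h) := rfl
theorem HB_coord (F : PS) (hF : Schur F) (w : H) (hw : ‖w‖ < 1) (h : HS) (m : ℕ) :
    (HB F hF w hw h) m = h m - w * ((L F hF).adjoint h) m := by
  rw [HB_apply, lp.coeFn_sub, Pi.sub_apply, LC_apply]

theorem inner_LC {w : H} (hw : ‖w‖ ≤ 1) (hw' : ‖star w‖ ≤ 1) (x y : HS) :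
    inner ℝ (L (C w) (Schur.C hw) x) y = inner ℝ x (L (C (star w)) (Schur.C hw') y) := by
  rw [lp.inner_eq_tsum, lp.inner_eq_tsum]
  congr 1; funext m
  rw [LC_apply, LC_apply, inner_mul']

theorem inner_HB (F : PS) (hF : Schur F) (w : H) (hw : ‖w‖ < 1) (h x y : HS)
    (hy : ser y = (1 - F * C (star w)) * ser x) : inner ℝ (HB F hF w hw h) x = inner ℝ h y := by
  have hw' : ‖star w‖ ≤ 1 := by rw [norm_star]; exact hw.le
  rw [HB_apply, inner_sub_left, inner_LC hw.le hw', ContinuousLinearMap.adjoint_inner_left, ← inner_sub_right]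
  congr 1
  apply ser_inj
  rw [hy, ser_sub, ser_L, ser_L]
  simp only [sub_mul, one_mul, mul_assoc]

theorem W1 {F F' : PS} (hF : Schur F) (hF' : Schur F') {w : H} (hw : ‖w‖ < 1)
    (h : (1 - F * C (star w)) * F' = F - C w) (x : HS) :
    ‖(L F' hF').adjoint (HB F hF w hw x)‖ ^ 2 - ‖HB F hF w hw x‖ ^ 2 =
      (1 - ‖w‖ ^ 2) * (‖(L F hF).adjoint x‖ ^ 2 - ‖x‖ ^ 2) := by
  have hw' : ‖star w‖ ≤ 1 := by rw [norm_star]; exact hw.le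
  have e : (L F' hF').adjoint (HB F hF w hw x) =
      (L F hF).adjoint x - L (C (star w)) (Schur.C hw') x := by
    apply HS_ext
    intro z
    have hsw : ‖star (star w)‖ ≤ 1 := by rw [star_star]; exact hw.le
    rw [ContinuousLinearMap.adjoint_inner_left, inner_sub_left, ContinuousLinearMap.adjoint_inner_left,
      inner_LC hw' hsw, ← inner_sub_right]
    apply inner_HB
    rw [ser_sub, ser_L, ser_L, ser_L, ← mul_assoc, h, star_star, sub_mul]
  rw [e, ← (hasSum_norm _).tsum_eq, ← (hasSum_norm (HB F hF w hw x)).tsum_eq, ← (hasSum_norm x).tsum_eq,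
    ← (hasSum_norm ((L F hF).adjoint x)).tsum_eq, ← (hasSum_norm _).summable.tsum_sub (hasSum_norm _).summable,
    ← (hasSum_norm _).summable.tsum_sub (hasSum_norm _).summable, ← tsum_mul_left]
  congr 1; funext m
  rw [HB_coord, lp.coeFn_sub, Pi.sub_apply, LC_apply]
  have := key_id (star w) (((L F hF).adjoint x) m) (x m)
  rwa [star_star, norm_star] at this

theorem HB_ne {F : PS} (hF : Schur F) {w : H} (hw : ‖w‖ < 1) {x : HS} (hx : x ≠ 0) : HB F hF w hw x ≠ 0 := by
  intro h
  have h1 : ∀ m, ‖x m‖ ^ 2 = ‖w‖ ^ 2 * ‖((L F hF).adjoint x) m‖ ^ 2 := by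
    intro m
    have := HB_coord F hF w hw x m
    rw [h, lp.coeFn_zero, Pi.zero_apply] at this
    rw [sub_eq_zero.mp this.symm, norm_mul, mul_pow]
  have h2 : ‖x‖ ^ 2 = ‖w‖ ^ 2 * ‖(L F hF).adjoint x‖ ^ 2 := by
    rw [← (hasSum_norm x).tsum_eq, ← (hasSum_norm ((L F hF).adjoint x)).tsum_eq, ← tsum_mul_left]
    congr 1; funext m; exact h1 m
  have h3 := Ladj_le F hF x
  have h4 := norm_pos_iff.mpr hx
  have h5 : ‖w‖ ^ 2 < 1 := by nlinarith [norm_nonneg w]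
  have h6 : ‖(L F hF).adjoint x‖ ^ 2 ≤ ‖x‖ ^ 2 := pow_le_pow_left₀ (norm_nonneg _) h3 2
  have h7 := mul_le_mul_of_nonneg_left h6 (sq_nonneg ‖w‖)
  have h8 : 0 < ‖x‖ ^ 2 := by positivity
  nlinarith

theorem Ladj_mul {F G : PS} (hF : Schur F) (hG : Schur G) (hFG : Schur (F * G)) (x : HS) :
    (L (F * G) hFG).adjoint x = (L G hG).adjoint ((L F hF).adjoint x) := by
  apply HS_ext
  intro z
  rw [ContinuousLinearMap.adjoint_inner_left, ContinuousLinearMap.adjoint_inner_left,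
    ContinuousLinearMap.adjoint_inner_left]
  congr 1
  apply ser_inj
  rw [ser_L, ser_L, ser_L, mul_assoc]
theorem LCu_adj {u : H} (hu : ‖u‖ = 1) (x : HS) : ‖(L (C u) (Schur.C hu.le)).adjoint x‖ = ‖x‖ := by
  have hu' : ‖star u‖ ≤ 1 := by rw [norm_star, hu]
  have : (L (C u) (Schur.C hu.le)).adjoint x = L (C (star u)) (Schur.C hu') x := by
    apply HS_ext
    intro z
    rw [ContinuousLinearMap.adjoint_inner_left, real_inner_comm, inner_LC hu.le hu', real_inner_comm]
  rw [this]
  have h2 : ‖L (C (star u)) (Schur.C hu') x‖ ^ 2 = ‖x‖ ^ 2 := by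
    rw [← (hasSum_norm x).tsum_eq, ← (hasSum_norm _).tsum_eq]
    congr 1; funext m
    rw [LC_apply, norm_mul, norm_star, hu, one_mul]
  exact (sq_eq_sq₀ (norm_nonneg _) (norm_nonneg _)).mp h2



theorem inversion {F : PS} {p w u : H} (hp : ‖p‖ < 1) (hw : ‖w‖ < 1) (hu : ‖u‖ = 1)
    (h : HD F p w (C u)) : IsMob F := by
  set c : H := 1 - p * u * star w with hc
  have huu : star u * u = 1 := by rw [star_sq, hu]; simp
  have huu' : u * star u = 1 := by rw [sq_star, hu]; simp
  have hc0 : c ≠ 0 := by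
    apply one_sub_ne
    rw [norm_mul, norm_mul, norm_star, hu]; nlinarith [norm_nonneg p, norm_nonneg w]
  have hcs : star c = 1 - w * star u * star p := by simp [hc, mul_assoc]
  set u' : H := c⁻¹ * (u - star p * w) with hu'
  set P : H := c⁻¹ * (star p - u * star w) with hP
  have hpu : star P * u' = c⁻¹ * (p * u - w) := by
    have h1 : star P = (p - w * star u) * (star c)⁻¹ := by simp [hP]
    have hr1 : p * star p = ((‖p‖ ^ 2 : ℝ) : H) := sq_star p
    have hr2 : star p * p = ((‖p‖ ^ 2 : ℝ) : H) := star_sq p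
    have h2 : (p - w * star u) * (u - star p * w) = star c * (p * u - w) := by
      have e1 : w * star u * (star p * p) * u = (star p * p) * w := by
        rw [hr2, ← Quaternion.coe_commutes, mul_assoc, mul_assoc w, huu, mul_one]
      have e2 : p * star p * w = star p * p * w := by rw [hr1, hr2]
      rw [hcs]
      calc _ = p * u - p * star p * w - w * (star u * u) + w * star u * star p * w := by noncomm_ring
        _ = p * u - w * star u * (star p * p) * u - w + w * star u * star p * w := by rw [huu, e1, e2, mul_one]
        _ = _ := by noncomm_ring
    have hcc : c * star c = ((‖c‖ ^ 2 : ℝ) : H) := sq_star c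
    have hcc' : star c * c = c * star c := by rw [sq_star, star_sq]
    have hcs0 : star c ≠ 0 := by simpa using hc0
    have hcomm : (star c)⁻¹ * c⁻¹ = ((‖c‖ ^ 2 : ℝ) : H)⁻¹ := by rw [← hcc, mul_inv_rev]
    rw [h1, hu', mul_assoc, ← mul_assoc (star c)⁻¹, hcomm, ← Quaternion.coe_inv, Quaternion.coe_commutes, ← mul_assoc, h2,
      ← Quaternion.coe_commutes, Quaternion.coe_inv, ← hcc, mul_inv_rev]
    rw [← mul_assoc]
    congr 1
    have : (star c)⁻¹ * c⁻¹ = c⁻¹ * (star c)⁻¹ := by rw [← mul_inv_rev, ← mul_inv_rev, hcc']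
    rw [this, mul_assoc, inv_mul_cancel₀ hcs0, mul_one]
  refine ⟨star P, u', ?_, ?_, ?_⟩
  · rw [norm_star, hP, norm_mul, norm_inv, inv_mul_lt_one₀ (norm_pos_iff.mpr hc0)]
    have hk := key_id (w * star u) p 1
    have e1 : ‖p - w * star u * 1‖ = ‖star p - u * star w‖ := by
      rw [mul_one, ← norm_star]; congr 1; simp
    have e2 : ‖1 - star (w * star u) * p‖ = ‖c‖ := by
      rw [norm_one_sub_comm, hc]; congr 1; simp [mul_assoc]
    rw [e1, e2, norm_mul, norm_star, hu, mul_one, norm_one] at hk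
    have : 0 < (1 - ‖w‖ ^ 2) * (1 - ‖p‖ ^ 2) := mul_pos (by nlinarith [norm_nonneg w]) (by nlinarith [norm_nonneg p])
    exact lt_of_pow_lt_pow_left₀ 2 (norm_nonneg _) (by nlinarith)
  · have e : ‖u - star p * w‖ = ‖c‖ := by
      have e1 : u - star p * w = (1 - star p * (w * star u)) * u := by
        rw [sub_mul, one_mul, mul_assoc, mul_assoc, huu, mul_one]
      rw [e1, norm_mul, hu, mul_one, norm_one_sub_comm, ← hcs, norm_star]
    rw [hu', norm_mul, norm_inv, e, inv_mul_cancel₀ (norm_ne_zero_iff.mpr hc0)]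
  · have hcc : (C c : PS) ≠ 0 := by simpa using hc0
    apply mul_left_cancel₀ hcc
    have e1 : C c * den (star P) = den p + lin p * C u * C (star w) := by
      rw [den, star_star, mul_sub, mul_one, CX', ← map_mul, hP, mul_inv_cancel_left₀ hc0, hc]
      simp only [den, lin, map_sub, map_mul, map_one, sub_mul, mul_sub, mul_assoc]
      abel
    have e2 : C c * (lin (star P) * C u') = den p * C w + lin p * C u := by
      rw [lin, sub_mul, mul_sub, CX', ← map_mul, ← map_mul, ← map_mul, hpu, hu', mul_inv_cancel_left₀ hc0,
        mul_inv_cancel_left₀ hc0]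
      simp only [den, lin, map_sub, map_mul, map_one, sub_mul, mul_sub, mul_assoc, one_mul]
      abel
    rw [← mul_assoc, e1, e2]
    have h' := h
    rw [HD, mul_sub, mul_sub, mul_one] at h'
    have : lin p * C u = den p * F - den p * C w + lin p * C u * (C (star w) * F) := by rw [← h']; abel
    rw [add_mul, mul_assoc _ _ F]
    nth_rewrite 2 [this]; abel

theorem exists_HD {F : PS} (hF : Schur F) {p : H} (hp : ‖p‖ < 1) (hw : ‖ev F p‖ < 1) :
    ∃ g, HD F p (ev F p) g := by
  have := hdq_HD (a := fun m => coeff m F) (by rw [mk_coeff]; exact hF) hp hw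
  rw [mk_coeff] at this
  exact ⟨_, this⟩

theorem ev_at_zero (F : PS) : ev F 0 = coeff 0 F := by
  rw [ev, evalC, tsum_eq_single 0]
  · simp
  · intro m hm; simp [hm]

theorem finishing {G K A : PS} (hG : Schur G) (hGK : G * K = A) (hK : ∀ m, 2 ≤ m → coeff m K = 0)
    (hA : ∀ m, 2 ≤ m → coeff m A = 0) (hn : NN 2 K = NN 2 A) (h0 : K ≠ 0) :
    IsMob G ∨ ∃ u, ‖u‖ = 1 ∧ G = C u := by
  have h00 : ‖(0 : H)‖ < 1 := by simp
  obtain ⟨hE1, hE2⟩ := E_lemma hG h00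
  rcases hE1.eq_or_lt with h1 | h1
  · exact Or.inr ⟨_, h1, hE2 h1⟩
  left
  obtain ⟨Γ, hΓ⟩ := exists_HD hG h00 h1
  have hΓs := HD_schur hG h00 h1 hΓ
  obtain ⟨G', e1, e2, e3, e4⟩ := HD_bullet hG h1 hΓ
  set g := ev G 0
  have e3' : X * Γ = G' := by simpa [lin, den] using e3
  set K' := (1 - C (star g) * G) * K with hK'
  have e5 : X * (Γ * K') = A - C g * K := by
    rw [← mul_assoc, e3', hK', ← mul_assoc, e1, sub_mul, hGK]
  have hK'm : ∀ m, coeff m K' = coeff m K - star g * coeff m A := by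
    intro m; rw [hK', sub_mul, one_mul, mul_assoc, hGK, map_sub, coeff_C_mul]
  have hNN := NN_key G K g 2
  rw [hGK, hn, sub_self, mul_zero, sub_mul, hGK, ← e5, ← hK'] at hNN
  have c2 := congrArg (coeff 2) e5
  rw [coeff_succ_X_mul, map_sub, coeff_C_mul, hA 2 le_rfl, hK 2 le_rfl] at c2
  simp only [NN, Finset.sum_range_succ, Finset.sum_range_zero, zero_add] at hNN
  have hz : coeff 1 (X * (Γ * K')) = coeff 0 (Γ * K') := coeff_succ_X_mul 0 _
  have hm0 : coeff 0 (Γ * K') = coeff 0 Γ * coeff 0 K' := by simp [coeff_mul]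
  rw [coeff_zero_X_mul, hz, hm0] at hNN
  have hΓ0 := hΓs.coeff_le 0
  simp only [norm_mul, norm_zero] at hNN
  have hK0 : coeff 0 K' ≠ 0 := by
    intro hz0
    rw [hz0] at hNN
    simp only [norm_zero] at hNN
    have hz1 : coeff 1 K' = 0 := by
      rw [← norm_eq_zero]; nlinarith [norm_nonneg (coeff 1 K')]
    have : K' = 0 := by
      ext1 m
      rcases m with _ | _ | m
      · simpa using hz0
      · simpa using hz1
      · rw [hK'm, hA _ (by omega), hK _ (by omega)]; simp
    obtain ⟨U, h5, h6⟩ := unit_den hG h1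
    apply h0
    rw [← one_mul K, ← h6, mul_assoc, ← hK', this, mul_zero]
  have hΓ1 : ‖coeff 0 Γ‖ = 1 := by
    have hp := norm_pos_iff.mpr hK0
    by_contra hne
    have hlt := lt_of_le_of_ne hΓ0 hne
    have : ‖coeff 0 Γ‖ * ‖coeff 0 K'‖ < ‖coeff 0 K'‖ := by nlinarith
    nlinarith [sq_nonneg ‖coeff 1 K'‖, mul_nonneg (norm_nonneg (coeff 0 Γ)) hp.le]
  rw [← ev_at_zero] at hΓ1
  have := (E_lemma hΓs h00).2 hΓ1
  rw [this] at hΓ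
  exact inversion h00 h1 hΓ1 hΓ



def evL (q : H) (hq : ‖q‖ < 1) : HS →ₗ[ℝ] H where
  toFun x := ev (ser x) q
  map_add' x y := by rw [ser_add, ev_add (ser_sa x hq) (ser_sa y hq)]
  map_smul' c x := by
    have : ev (ser x) q = ∑' m, q ^ m * x m := by rw [ev, evalC]; simp only [coeff_ser]
    rw [this, ev, evalC, RingHom.id_apply, ← tsum_const_smul'']
    congr 1; funext m
    rw [coeff_ser, lp.coeFn_smul, Pi.smul_apply, mul_smul_comm]

def eF (r : H) (e : H × H × H) : ℕ → H
  | 0 => e.1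
  | 1 => e.2.1
  | m + 2 => star r ^ m * e.2.2
theorem eF_sum {r : H} (hr : ‖r‖ < 1) (e : H × H × H) : Summable fun m => ‖coeff m (mk (eF r e) : PS)‖ ^ 2 := by
  rw [← summable_nat_add_iff 2]
  refine (kerS_summable hr e.2.2).congr fun m => ?_
  simp [eF, kerS]
def eL (r : H) (hr : ‖r‖ < 1) : H × H × H →ₗ[ℝ] HS where
  toFun e := ofPS (mk (eF r e)) (eF_sum hr e)
  map_add' x y := by
    apply ser_inj
    rw [ser_add, ser_ofPS, ser_ofPS, ser_ofPS]
    ext1 m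
    rcases m with _ | _ | m <;> simp [eF, mul_add]
  map_smul' c x := by
    apply ser_inj
    rw [ser_ofPS]
    ext1 m
    rw [coeff_mk, coeff_ser, RingHom.id_apply, lp.coeFn_smul, Pi.smul_apply, ← coeff_ser, ser_ofPS, coeff_mk]
    rcases m with _ | _ | m <;> simp [eF]
theorem eL_apply (r : H) (hr : ‖r‖ < 1) (e : H × H × H) (m : ℕ) : (eL r hr e) m = eF r e m := by
  rw [← coeff_ser]; show coeff m (ser (ofPS _ (eF_sum hr e))) = _; rw [ser_ofPS, coeff_mk]
theorem eL_ne (r : H) (hr : ‖r‖ < 1) {e : H × H × H} (he : e ≠ 0) : eL r hr e ≠ 0 := by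
  intro h
  apply he
  have hm : ∀ m, eF r e m = 0 := fun m => by rw [← eL_apply r hr, h]; rfl
  have h0 := hm 0
  have h1 := hm 1
  have h2 := hm 2
  simp [eF] at h0 h1 h2
  exact Prod.ext h0 (Prod.ext h1 h2)

theorem inner_eL (r : H) (hr : ‖r‖ < 1) (e : H × H × H) (y : HS) (Y : PS) (hY : SA Y ‖r‖)
    (h : ser y = X * (X * Y)) : inner ℝ (eL r hr e) y = inner ℝ e.2.2 (ev Y r) := by
  have hy0 : y 0 = 0 := by rw [← coeff_ser, h, coeff_zero_X_mul]
  have hy1 : y 1 = 0 := by rw [← coeff_ser, h, coeff_succ_X_mul, coeff_zero_X_mul]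
  have hy2 : ∀ m, y (m + 2) = coeff m Y := by
    intro m; rw [← coeff_ser, h, coeff_succ_X_mul, coeff_succ_X_mul]
  have hs := lp.summable_inner (𝕜 := ℝ) (eL r hr e) y
  rw [lp.inner_eq_tsum, ← hs.sum_add_tsum_nat_add 2]
  simp only [Finset.sum_range_succ, Finset.sum_range_zero, hy0, hy1, inner_zero_right, zero_add, hy2, eL_apply]
  rw [ev, evalC, ← innerSL_apply_apply ℝ e.2.2, ContinuousLinearMap.map_tsum _ hY.summable]
  congr 1; funext m
  rw [innerSL_apply_apply, eF, ← star_pow, inner_mul]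

theorem coord_zero {x : HS} {m : ℕ} (h : ∀ (c : H) (y : HS), ser y = X ^ m * C c → inner ℝ x y = 0) : x m = 0 := by
  have hsum : Summable fun l => ‖coeff l (X ^ m * C (x m) : PS)‖ ^ 2 := by
    apply summable_of_ne_finset_zero (s := {m})
    intro l hl
    simp at hl
    simp [coeff_X_pow, hl]
  have h1 := h (x m) (ofPS _ hsum) (ser_ofPS _ _)
  rw [lp.inner_eq_tsum, tsum_eq_single m] at h1
  · rw [← coeff_ser (ofPS _ hsum), ser_ofPS] at h1
    simp at h1
    exact h1
  · intro l hl
    rw [← coeff_ser (ofPS _ hsum), ser_ofPS]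
    simp [coeff_X_pow, hl]

theorem general {F : PS} (hF : Schur F) {p r : H} (hp : ‖p‖ < 1) (hr : ‖r‖ < 1) (hwp : ‖ev F p‖ < 1)
    (hwr : ‖ev F r‖ < 1) {g G : PS} (hg : HD F p (ev F p) g) (hgM : IsMob g) (hG : HD F r (ev F r) G) :
    IsMob G ∨ ∃ u, ‖u‖ = 1 ∧ G = C u := by
  have hgs := HD_schur hF hp hwp hg
  have hGs := HD_schur hF hr hwr hG
  obtain ⟨t, u, ht, hu, htu⟩ := hgM
  have htu' : g = Mo t * C u := eq_Mo_mul htu.symm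
  obtain ⟨Fp, -, hp2, hp3, hp4⟩ := HD_bullet hF hwp hg
  obtain ⟨Fr, -, hr2, hr3, hr4⟩ := HD_bullet hF hwr hG
  have hFp := eq_Mo_mul hp3
  have hFr := eq_Mo_mul hr3
  set Ap := (L (Mo p) (Schur_Mo hp)).adjoint
  set B := HB F hF (ev F p) hwp with hB
  let T : H × H × H →ₗ[ℝ] H × H :=
    ((evL p hp).prod ((evL t ht).comp Ap.toLinearMap)).comp (B.toLinearMap.comp (eL r hr))
  have hfr : Module.finrank ℝ H = 4 := Quaternion.finrank_eq_four
  have hker : LinearMap.ker T ≠ ⊥ := by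
    apply LinearMap.ker_ne_bot_of_finrank_lt
    simp only [Module.finrank_prod, hfr]; norm_num
  obtain ⟨e, heT, he0⟩ := Submodule.exists_mem_ne_zero_of_ne_bot hker
  have hT : T e = 0 := heT
  have hT1 : ev (ser (B (eL r hr e))) p = 0 := congrArg Prod.fst hT
  have hT2 : ev (ser (Ap (B (eL r hr e)))) t = 0 := congrArg Prod.snd hT
  set h := eL r hr e with hh
  have h0 : h ≠ 0 := eL_ne r hr he0
  have hn1 : ‖(L Fp hp4).adjoint (B h)‖ = ‖B h‖ := by
    subst hFp
    rw [Ladj_mul (Schur_Mo hp) hgs hp4]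
    have : ∀ x, ‖(L g hgs).adjoint x‖ = ‖(L (Mo t) (Schur_Mo ht)).adjoint x‖ := by
      intro x
      subst htu'
      rw [Ladj_mul (Schur_Mo ht) (Schur.C hu.le) hgs, LCu_adj hu]
    rw [this, Mo_isom ht _ hT2, Mo_isom hp _ hT1]
  have hn2 : ‖(L F hF).adjoint h‖ ^ 2 - ‖h‖ ^ 2 = 0 := by
    have := W1 hF hp4 hwp hp2 h
    rw [← hB, hn1, sub_self] at this
    rcases mul_eq_zero.mp this.symm with h1 | h1
    · nlinarith [norm_nonneg (ev F p)]
    · exact h1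
  set h1 := HB F hF (ev F r) hwr h with hh1
  have h10 : h1 ≠ 0 := HB_ne hF hwr h0
  have hn3 : ‖(L Fr hr4).adjoint h1‖ = ‖h1‖ := by
    have := W1 hF hr4 hwr hr2 h
    rw [hn2, mul_zero, ← hh1] at this
    exact (sq_eq_sq₀ (norm_nonneg _) (norm_nonneg _)).mp (sub_eq_zero.mp this)
  set h2 := (L (Mo r) (Schur_Mo hr)).adjoint h1 with hh2
  set k := (L G hGs).adjoint h2 with hk
  have hn4 : ‖k‖ = ‖h1‖ := by
    rw [← hn3]
    subst hFr
    rw [Ladj_mul (Schur_Mo hr) hGs hr4]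
  have hn5 : ‖h2‖ = ‖h1‖ := le_antisymm (Ladj_le _ _ _) (by rw [← hn4]; exact Ladj_le _ _ _)
  have hGk : L G hGs k = h2 := by
    have e1 := norm_sub_sq_real (L G hGs k) h2
    have e2 : inner ℝ (L G hGs k) h2 = ‖k‖ ^ 2 := by
      rw [real_inner_comm, ← ContinuousLinearMap.adjoint_inner_left, ← hk, real_inner_self_eq_norm_sq]
    have e3 : ‖L G hGs k‖ ^ 2 ≤ ‖k‖ ^ 2 := pow_le_pow_left₀ (norm_nonneg _) (L_le _ _ _) 2
    rw [e2, hn5, ← hn4] at e1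
    have e4 : ‖L G hGs k - h2‖ ^ 2 = 0 := le_antisymm (by linarith) (sq_nonneg _)
    exact sub_eq_zero.mp (norm_eq_zero.mp (pow_eq_zero_iff two_ne_zero |>.mp e4))
  have hz2 : ∀ m, 2 ≤ m → h2 m = 0 := by
    intro m hm
    apply coord_zero
    intro c y hy
    obtain ⟨m, rfl⟩ := Nat.exists_eq_add_of_le' hm
    have hXs : Schur (X ^ m : PS) := by
      clear hm hy
      induction m with
      | zero => intro n k; simp
      | succ m ih => rw [pow_succ]; exact ih.mul Schur_X
    have hsZ : SA (Mo r * (X ^ m * C c)) ‖r‖ := ((Schur_Mo hr).sa hr).mul (norm_nonneg _)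
      ((hXs.sa hr).mul (norm_nonneg _) (SA.C _ _))
    have hsY := (sa_oneSub hF hr (ev F r)).mul (norm_nonneg _) hsZ
    have hevY : ev ((1 - F * C (star (ev F r))) * (Mo r * (X ^ m * C c))) r = 0 := by
      rw [ev_real (sa_oneSub hF hr _) hsZ (ev_oneSub hF hr),
        ev_zero_mul ((Schur_Mo hr).sa hr) ((hXs.sa hr).mul (norm_nonneg _) (SA.C _ _)) (ev_Mo hr), mul_zero]
    set x := L (Mo r) (Schur_Mo hr) y with hx
    have hw' : ‖star (ev F r)‖ ≤ 1 := by rw [norm_star]; exact hwr.le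
    set y' : HS := x - L F hF (L (C (star (ev F r))) (Schur.C hw') x) with hy'
    have hsy' : ser y' = (1 - F * C (star (ev F r))) * ser x := by
      rw [ser_sub, ser_L F, ser_L (C (star (ev F r))), sub_mul, one_mul, mul_assoc]
    rw [hh2, ContinuousLinearMap.adjoint_inner_left, ← hx, hh1, inner_HB F hF (ev F r) hwr h x y' hsy', hh,
      inner_eL r hr e y' _ hsY, hevY, inner_zero_right]
    rw [hsy', hx, ser_L, hy, pow_succ, pow_succ, FX (X ^ m), FX (X * X ^ m)]
    simp only [mul_assoc, FX']
  have hzk : ∀ m, 2 ≤ m → k m = 0 := by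
    intro m hm
    apply coord_zero
    intro c y hy
    obtain ⟨m, rfl⟩ := Nat.exists_eq_add_of_le' hm
    rw [hk, ContinuousLinearMap.adjoint_inner_left, lp.inner_eq_tsum]
    have : ∀ l, inner ℝ (h2 l) ((L G hGs y) l) = 0 := by
      intro l
      rcases lt_or_ge l 2 with hl | hl
      · have : (L G hGs y) l = 0 := by
          rw [← coeff_ser, ser_L, hy, pow_succ, pow_succ, FX (X ^ m), FX (X * X ^ m)]
          simp only [mul_assoc, FX']
          interval_cases l
          · rw [coeff_zero_X_mul]
          · rw [coeff_succ_X_mul, coeff_zero_X_mul]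
        rw [this, inner_zero_right]
      · rw [hz2 l hl, inner_zero_left]
    simp [this]
  have hNN : ∀ x : HS, (∀ m, 2 ≤ m → x m = 0) → ‖x‖ ^ 2 = NN 2 (ser x) := by
    intro x hx
    rw [← (hasSum_norm x).tsum_eq, NN, tsum_eq_sum (s := Finset.range 2)]
    · simp only [coeff_ser]
    · intro m hm
      simp at hm
      simp [hx m hm]
  apply finishing hGs (K := ser k) (A := ser h2)
  · rw [← ser_L _ hGs, hGk]
  · intro m hm; rw [coeff_ser, hzk m hm]
  · intro m hm; rw [coeff_ser, hz2 m hm]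
  · rw [← hNN k hzk, ← hNN h2 hz2, hn4, hn5]
  · intro hk0
    have : k = 0 := ser_inj (by rw [hk0]; ext1 m; simp [ser])
    rw [this, norm_zero] at hn4
    exact h10 (norm_eq_zero.mp hn4.symm)



theorem Mob_right {g : PS} {t u : H} (hu : ‖u‖ = 1) (h : den t * g = lin t * C u) :
    g * (1 - X * C (star u * star t * u)) = lin t * C u := by
  have huu' : u * star u = 1 := by rw [sq_star, hu]; simp
  have hg := eq_Mo_mul h.symm
  rw [hg, mul_assoc, mul_sub, mul_one, FX', ← map_mul, ← mul_assoc, ← mul_assoc, huu', one_mul]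
  have : (C u : PS) - X * C (star t * u) = den t * C u := by
    rw [den, sub_mul, one_mul, mul_assoc, ← map_mul]
  rw [this, ← mul_assoc, mobius_den]

theorem mob_const {g : PS} (hgs : Schur g) (hg : IsMob g) {s : H} (hs : ‖s‖ < 1) (hw : ‖ev g s‖ < 1) {G : PS}
    (hG : HD g s (ev g s) G) : ∃ u, ‖u‖ = 1 ∧ G = C u := by
  obtain ⟨t, u, ht, hu, h⟩ := hg
  have huu' : u * star u = 1 := by rw [sq_star, hu]; simp
  have huu : star u * u = 1 := by rw [star_sq, hu]; simp
  have hr := Mob_right hu h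
  have he := ev_mul_oneSub (hgs.sa hs) (star u * star t * u)
  rw [hr, ev_mul_C (SA.lin _ (norm_nonneg _)), ev_lin] at he
  set w := ev g s with hwd
  set x := t * u with hx
  have hxn : ‖x‖ < 1 := by rw [hx, norm_mul, hu, mul_one]; exact ht
  have hτ : star u * star t * u = star x * u := by simp [hx]
  rw [hτ] at he hr
  set N := 1 + x * star w with hN
  have hNs : star N = 1 + w * star x := by simp [hN]
  set C' := 1 + star w * x with hC'
  have hN0 : N ≠ 0 := by
    have := one_sub_ne (x := -(x * star w)) (by rw [norm_neg, norm_mul, norm_star]; nlinarith [norm_nonneg x, norm_nonneg w])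
    rwa [sub_neg_eq_add] at this
  have hC0 : C' ≠ 0 := by
    have := one_sub_ne (x := -(star w * x)) (by rw [norm_neg, norm_mul, norm_star]; nlinarith [norm_nonneg x, norm_nonneg w])
    rwa [sub_neg_eq_add] at this
  have hnorm : ‖N‖ = ‖C'‖ := by
    have := norm_one_sub_comm (-x) (star w)
    simpa [hN, hC'] using this
  set A := star N * u with hA
  have hsA : s * A = x + w := by
    rw [hA, hNs, add_mul, one_mul, mul_add]
    have : s * u = w - s * w * (star x * u) + x := by rw [← he, sub_mul, hx]; abel
    rw [this]; simp only [mul_assoc]; abel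
  have hsb : star s = N⁻¹ * (u * (star x + star w)) := by
    have h1 := congrArg star hsA
    rw [star_mul, hA, star_mul, star_star, star_add] at h1
    rw [← h1, ← mul_assoc u, ← mul_assoc u, huu', one_mul, inv_mul_cancel_left₀ hN0]
  have hh1 : C'⁻¹ * (star x + star w) = (star x + star w) * N⁻¹ := by
    rw [inv_mul_eq_iff_eq_mul₀ hC0, ← mul_assoc, eq_mul_inv_iff_mul_eq₀ hN0]
    have e1 : star x * x * star w = star w * (x * star x) := by
      rw [star_sq, sq_star, Quaternion.coe_commutes]
    rw [hN, hC']
    calc _ = star x + star w + star x * x * star w + star w * x * star w := by noncomm_ring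
      _ = _ := by rw [e1]; noncomm_ring
  have hNi : N⁻¹ = (((‖N‖ ^ 2)⁻¹ : ℝ) : H) * star N := by
    rw [inv_eq_iff_eq_inv, mul_inv_rev, Quaternion.coe_inv, inv_inv, eq_comm, inv_mul_eq_iff_eq_mul₀ (by simpa using hN0), star_sq]
  have key : A * C'⁻¹ * (star x * u + star w * u) = star s * A := by
    rw [← add_mul, mul_assoc, ← mul_assoc C'⁻¹, hh1, hsb, hA, hNi]
    have cm : ∀ (r : ℝ) (a b : H), a * ((r : H) * b) = r * (a * b) := fun r a b => by
      rw [← mul_assoc, ← Quaternion.coe_commutes, mul_assoc]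
    simp only [mul_assoc, cm]
  refine ⟨A * C'⁻¹, ?_, ?_⟩
  · rw [hA, norm_mul, norm_mul, norm_star, hu, norm_inv, hnorm, mul_one, mul_inv_cancel₀ (norm_ne_zero_iff.mpr hC0)]
  · apply HD_unique hgs hw hG
    have hD : (1 - X * C (star x * u) : PS) ≠ 0 := by
      intro h; have := congrArg (coeff 0) h; simp at this
    rw [HD]
    apply mul_right_cancel₀ hD
    have e1 : (1 - C (star w) * g) * (1 - X * C (star x * u)) = C C' - X * C (star x * u + star w * u) := by
      rw [sub_mul, one_mul, mul_assoc, hr, hC', lin]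
      simp only [sub_mul, mul_sub, map_add, map_one, map_mul, hx, CX', mul_add]
      simp only [← mul_assoc]
      abel
    have e2 : (g - C w) * (1 - X * C (star x * u)) = lin s * C A := by
      rw [sub_mul, hr, lin, lin, sub_mul, sub_mul, ← map_mul _ s, hsA, hA, hNs]
      simp only [mul_sub, mul_one, map_add, map_mul, map_one, hx, CX', add_mul, mul_add, one_mul, mul_assoc]
      abel
    rw [mul_assoc, e1, mul_assoc (den s), e2, ← mul_assoc (den s), ← lin_den, mul_assoc (lin s), mul_assoc (lin s)]
    congr 1
    rw [mul_sub, CX', ← map_mul, ← map_mul, key, den, sub_mul, one_mul, mul_assoc X, ← map_mul,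
      mul_assoc A, inv_mul_cancel₀ hC0, mul_one]

theorem mobiusEval_eq {s q : H} (hs : ‖s‖ < 1) (hq : ‖q‖ < 1) : mobiusEval s q = ev (Mo s) q := by
  have h := ev_mul_oneSub ((Schur_Mo hs).sa hq) (star s)
  have h2 : Mo s * (1 - X * C (star s)) = lin s := mobius_den s
  rw [h2, ev_lin] at h
  set v := ev (Mo s) q
  set c := 1 - q * s with hc
  have hc0 : c ≠ 0 := one_sub_ne (by rw [norm_mul]; nlinarith [norm_nonneg s, norm_nonneg q])
  set D := c - q * c * star s with hD
  have hDe : c * (1 - mobiusT s q * star s) = D := by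
    rw [mobiusT, ← hc, mul_sub, mul_one, ← mul_assoc, ← mul_assoc, ← mul_assoc, mul_inv_cancel₀ hc0, one_mul]
  have hT : ‖mobiusT s q‖ = ‖q‖ := by
    rw [mobiusT, ← hc, norm_mul, norm_mul, norm_inv]
    have := norm_ne_zero_iff.mpr hc0
    field_simp
  have h10 : 1 - mobiusT s q * star s ≠ 0 := one_sub_ne (by rw [norm_mul, hT, norm_star]; nlinarith [norm_nonneg s, norm_nonneg q])
  have hD0 : D ≠ 0 := by rw [← hDe]; exact mul_ne_zero hc0 h10
  have hDy : D * mobiusEval s q = q * c - c * s := by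
    rw [← hDe, mobiusEval, mobiusM, mul_assoc, mul_inv_cancel_left₀ h10, mobiusT, ← hc, mul_sub, ← mul_assoc,
      ← mul_assoc, mul_inv_cancel₀ hc0, one_mul]
  obtain ⟨R, hR⟩ : ∃ R : ℝ, star s = (R : H) - s := ⟨2 * s.re, by rw [eq_sub_iff_add_eq, add_comm, Quaternion.self_add_star]; simp; left; rfl⟩
  obtain ⟨S, hS⟩ : ∃ S : ℝ, s * star s = (S : H) := ⟨_, sq_star s⟩
  have cR : ∀ x : H, x * (R : H) = R * x := fun x => (Quaternion.coe_commutes R x).symm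
  have cS : ∀ x : H, x * (S : H) = S * x := fun x => (Quaternion.coe_commutes S x).symm
  have hDD : D = 1 - R * q + S * (q * q) := by
    rw [hD, hc, ← cR, ← cS, ← hS]
    have : (R : H) = star s + s := by rw [hR]; abel
    rw [this]; noncomm_ring
  have hss : s * s = R * s - S := by
    rw [← hS, hR, mul_sub, cR]; abel
  have hDq : D * q = q * D := by
    rw [hDD, add_mul, sub_mul, mul_add, mul_sub, ← mul_assoc q (R : H), ← mul_assoc q (S : H), cR, cS]; noncomm_ring
  have hid : (q * c - c * s) - q * (q * c - c * s) * star s = D * (q - s) := by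
    rw [hDD, hc]
    have l1 : (q * (1 - q * s) - (1 - q * s) * s) - q * (q * (1 - q * s) - (1 - q * s) * s) * star s
      = q - s - (q * q) * (star s + s) + q * (s * s + s * star s) + q * q * q * (s * star s) - q * q * s * (s * star s) := by
      noncomm_ring
    have : star s + s = (R : H) := by rw [hR]; abel
    rw [l1, this, hS, hss, sub_add_cancel, ← mul_assoc q (R : H), cR, cR, cS, cS]
    noncomm_ring
  set y := mobiusEval s q
  have h3 : y - q * y * star s = q - s := by
    apply mul_left_cancel₀ hD0
    rw [mul_sub, ← mul_assoc, ← mul_assoc, hDq, mul_assoc q, hDy, hid]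
  have h4 : (y - v) - q * (y - v) * star s = 0 := by
    have : y - q * y * star s - (v - q * v * star s) = 0 := by rw [h3, ← h, sub_self]
    rw [← this]; noncomm_ring
  exact sub_eq_zero.mp (fix_zero hq (by rw [norm_star]; exact hs.le) h4)

theorem ev_Mo_ne {s q : H} (hs : ‖s‖ < 1) (hq : ‖q‖ < 1) (hne : q ≠ s) : ev (Mo s) q ≠ 0 := by
  intro h0
  have h := ev_mul_oneSub ((Schur_Mo hs).sa hq) (star s)
  have h2 : Mo s * (1 - X * C (star s)) = lin s := mobius_den s
  rw [h2, ev_lin, h0] at h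
  simp at h
  exact hne (sub_eq_zero.mp h)



theorem poly_root (a0 a1 a2 a3 : ℝ) (h : |a0| < 1) : ∃ z : ℂ, ‖z‖ < 1 ∧
    z ^ 4 + a3 * z ^ 3 + a2 * z ^ 2 + a1 * z + a0 = 0 := by
  classical
  set P : Polynomial ℂ := Polynomial.X ^ 4 + (Polynomial.C (a3 : ℂ) * Polynomial.X ^ 3 + Polynomial.C (a2 : ℂ) * Polynomial.X ^ 2 + Polynomial.C (a1 : ℂ) * Polynomial.X + Polynomial.C (a0 : ℂ)) with hP
  have hm : P.Monic := by
    apply Polynomial.monic_X_pow_add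
    compute_degree!
  have hc := Polynomial.Splits.coeff_zero_eq_prod_roots_of_monic (IsAlgClosed.splits P) hm
  have hc0 : P.coeff 0 = a0 := by simp [hP]
  by_contra! hcon
  have hr : ∀ z ∈ P.roots, 1 ≤ ‖z‖ := by
    intro z hz
    by_contra! hlt
    apply hcon z hlt
    have := (Polynomial.mem_roots'.mp hz).2
    rw [Polynomial.IsRoot, hP] at this
    simp at this
    rw [← this]; ring
  have hge : ∀ m : Multiset ℂ, (∀ z ∈ m, 1 ≤ ‖z‖) → 1 ≤ ‖m.prod‖ := by
    intro m
    induction m using Multiset.induction_on with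
    | empty => intro _; simp
    | cons z m ih =>
      intro hm
      rw [Multiset.prod_cons, norm_mul]
      have h1 := hm z (Multiset.mem_cons_self z m)
      have h2 := ih fun y hy => hm y (Multiset.mem_cons_of_mem hy)
      nlinarith
  have h2 := hge _ hr
  have h3 : ‖P.coeff 0‖ = ‖P.roots.prod‖ := by rw [hc]; simp
  rw [hc0, Complex.norm_real, Real.norm_eq_abs] at h3
  linarith

theorem nsq (q : H) : ‖q‖ ^ 2 = q.re ^ 2 + q.imI ^ 2 + q.imJ ^ 2 + q.imK ^ 2 := by
  rw [pow_two, ← Quaternion.normSq_eq_norm_mul_self, Quaternion.normSq_def']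

theorem q_sq (q : H) : q * q = ((2 * q.re : ℝ) : H) * q - ((‖q‖ ^ 2 : ℝ) : H) := by
  have : ((2 * q.re : ℝ) : H) = star q + q := by
    rw [add_comm, Quaternion.self_add_star]; simp; left; rfl
  rw [this, ← star_sq]; noncomm_ring

theorem quad_root (b c : H) (hc : ‖c‖ < 1) : ∃ t : H, ‖t‖ < 1 ∧ t * t - t * b + c = 0 := by
  have hc2 : |‖c‖ ^ 2| < 1 := by
    rw [abs_of_nonneg (sq_nonneg _)]; nlinarith [norm_nonneg c]
  obtain ⟨z, hz, hroot⟩ := poly_root (‖c‖ ^ 2)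
    (-2 * (b.re * c.re + b.imI * c.imI + b.imJ * c.imJ + b.imK * c.imK))
    (‖b‖ ^ 2 + 2 * c.re) (-2 * b.re) hc2
  obtain ⟨x, y⟩ := z
  have hn : x ^ 2 + y ^ 2 < 1 := by
    have : ‖(⟨x, y⟩ : ℂ)‖ ^ 2 < 1 := by nlinarith [norm_nonneg (⟨x, y⟩ : ℂ)]
    rw [← Complex.normSq_eq_norm_sq, Complex.normSq_mk] at this
    linarith
  set β : H := ((2 * x : ℝ) : H) - b with hβ
  set γ : H := c - ((x ^ 2 + y ^ 2 : ℝ) : H) with hγ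
  suffices hs : ∃ q : H, q.re = x ∧ ‖q‖ ^ 2 = x ^ 2 + y ^ 2 ∧ q * β + γ = 0 by
    obtain ⟨q, h1, h2, h3⟩ := hs
    refine ⟨q, ?_, ?_⟩
    · nlinarith [norm_nonneg q]
    · rw [q_sq, h1, h2, ← h3, hβ, hγ, mul_sub, Quaternion.coe_commutes]; abel
  set ip : ℝ := β.re * γ.re + β.imI * γ.imI + β.imJ * γ.imJ + β.imK * γ.imK with hip
  have hb := nsq b
  have hcc := nsq c
  have hββ := nsq β
  have hγγ := nsq γ
  have eb : β.re = 2 * x - b.re ∧ β.imI = - b.imI ∧ β.imJ = - b.imJ ∧ β.imK = - b.imK := by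
    simp [hβ, -Quaternion.coe_mul]
  have eg : γ.re = c.re - (x ^ 2 + y ^ 2) ∧ γ.imI = c.imI ∧ γ.imJ = c.imJ ∧ γ.imK = c.imK := by
    refine ⟨?_, ?_, ?_, ?_⟩ <;> simp [hγ, -Quaternion.coe_add]
  obtain ⟨eb0, eb1, eb2, eb3⟩ := eb
  obtain ⟨eg0, eg1, eg2, eg3⟩ := eg
  have him : y * (2 * x * ‖β‖ ^ 2 + 2 * ip) = 0 := by
    have := congrArg Complex.im hroot
    simp [pow_succ] at this
    rw [hββ, hip, eb0, eb1, eb2, eb3, eg0, eg1, eg2, eg3]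
    linear_combination this - 2 * x * y * hb
  have hre : x * (2 * x * ‖β‖ ^ 2 + 2 * ip) + ‖γ‖ ^ 2 - (x ^ 2 + y ^ 2) * ‖β‖ ^ 2 = 0 := by
    have := congrArg Complex.re hroot
    simp [pow_succ] at this
    rw [hββ, hip, hγγ, eb0, eb1, eb2, eb3, eg0, eg1, eg2, eg3]
    linear_combination this - (x ^ 2 - y ^ 2) * hb - hcc
  by_cases hy : y = 0
  · subst hy
    refine ⟨(x : H), by simp, by simp, ?_⟩
    have : ‖(x : H) * β + γ‖ ^ 2 = 0 := by
      rw [← hre, hββ, hγγ, hip, nsq]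
      simp
      ring
    simpa using this
  · have h1 : 2 * x * ‖β‖ ^ 2 + 2 * ip = 0 := by simpa [hy] using him
    rw [h1, mul_zero, zero_add] at hre
    by_cases hβ0 : β = 0
    · rw [hβ0] at hre
      have hγ0 : γ = 0 := by simpa using hre
      obtain ⟨q, q0, q1, q2, q3⟩ : ∃ q : H, q.re = x ∧ q.imI = y ∧ q.imJ = 0 ∧ q.imK = 0 :=
        ⟨⟨x, y, 0, 0⟩, rfl, rfl, rfl, rfl⟩
      refine ⟨q, q0, ?_, ?_⟩
      · rw [nsq, q0, q1, q2, q3]; ring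
      · rw [hβ0, hγ0]; simp
    · have hbn : ‖β‖ ^ 2 ≠ 0 := by simpa using hβ0
      have hβi : β⁻¹ = (((‖β‖ ^ 2)⁻¹ : ℝ) : H) * star β := by
        rw [inv_eq_iff_eq_inv, mul_inv_rev, Quaternion.coe_inv, inv_inv, eq_comm, inv_mul_eq_iff_eq_mul₀ (by simpa using hβ0), star_sq]
      refine ⟨-(γ * β⁻¹), ?_, ?_, ?_⟩
      · have : (γ * β⁻¹).re = (‖β‖ ^ 2)⁻¹ * ip := by
          rw [hβi, ← mul_assoc, ← Quaternion.coe_commutes, mul_assoc, Quaternion.coe_mul_eq_smul, Quaternion.re_smul, hip]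
          simp; left; ring
        rw [Quaternion.re_neg, this]
        field_simp
        linarith
      · rw [norm_neg, norm_mul, norm_inv, mul_pow, inv_pow]
        field_simp
        linarith
      · rw [neg_mul, mul_assoc, inv_mul_cancel₀ hβ0]; simp

theorem zero_exists {F g : PS} (hF : Schur F) (hw : ‖ev F 0‖ < 1) (hg : HD F 0 (ev F 0) g) (hgM : IsMob g)
    (hgs : Schur g) : ∃ t : H, ‖t‖ < 1 ∧ ev F t = 0 := by
  set w := ev F 0 with hwd
  have hg' : X * g * (1 - C (star w) * F) = F - C w := by simpa [HD, lin, den] using hg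
  obtain ⟨t, u, ht, hu, hM⟩ := hgM
  have huu' : u * star u = 1 := by rw [sq_star, hu]; simp
  have huu : star u * u = 1 := by rw [star_sq, hu]; simp
  have hr := Mob_right hu hM
  set τ := star u * star t * u with hτ
  have hτn : ‖τ‖ ≤ 1 := by rw [hτ, norm_mul, norm_mul, norm_star, norm_star, hu]; simpa using ht.le
  set c := w * star u with hcd
  set b := t + c * star t with hbd
  obtain ⟨q, hq, hroot⟩ := quad_root b c (by rw [hcd, norm_mul, norm_star, hu, mul_one]; exact hw)
  set B := X * g with hB
  have hsg := hgs.sa hq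
  have hn := norm_nonneg q
  have hsB : SA B ‖q‖ := SA.mul hn (SA.X _) hsg
  have hcu : c * u = w := by rw [hcd, mul_assoc, huu, mul_one]
  have hBw : (B + C w) * (1 - X * C τ) = (X * X - X * C b + C c) * C u := by
    rw [add_mul, hB, mul_assoc, hr, lin]
    simp only [sub_mul, mul_sub, mul_one, add_mul, CX', mul_assoc, ← map_mul, hcu]
    have : b * u = t * u + w * τ := by rw [hbd, add_mul, hτ, hcd]; simp only [mul_assoc]
    rw [this, map_add, mul_add]; abel
  have hy0 : ev (B + C w) q = 0 := by
    have e := ev_mul_oneSub (SA.add hn hsB (SA.C w ‖q‖)) τ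
    rw [hBw] at e
    have sXX := SA.mul hn (SA.X ‖q‖) (SA.X ‖q‖)
    have sXb := SA.mul hn (SA.X ‖q‖) (SA.C b ‖q‖)
    rw [ev_mul_C (SA.add hn (SA.sub hn sXX sXb) (SA.C c _)), ev_add (SA.sub hn sXX sXb) (SA.C c _), ev_sub sXX sXb,
      ev_X_mul (SA.X _), ev_X_mul (SA.C _ _), ev_X, ev_C, ev_C, hroot, zero_mul] at e
    exact fix_zero hq hτn e.symm
  have hBq : ev B q = - w := by
    rw [ev_add hsB (SA.C _ _), ev_C] at hy0
    exact eq_neg_of_add_eq_zero_left hy0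
  have hFF : (1 + B * C (star w)) * F = B + C w := by
    have : B + C w = B * (1 - C (star w) * F) + B * C (star w) * F + C w := by noncomm_ring
    rw [this, hg']; noncomm_ring
  have hs1 : SA (1 + B * C (star w)) ‖q‖ := SA.add hn (SA.one _) (SA.mul hn hsB (SA.C _ _))
  have he1 : ev (1 + B * C (star w)) q = ((1 - ‖w‖ ^ 2 : ℝ) : H) := by
    rw [ev_add (SA.one _) (SA.mul hn hsB (SA.C _ _)), ev_one, ev_mul_C hsB, hBq, neg_mul, sq_star]
    push_cast; abel
  have := ev_real hs1 (hF.sa hq) he1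
  rw [hFF, hy0] at this
  refine ⟨q, hq, ?_⟩
  have hne : (1 - ‖w‖ ^ 2 : ℝ) ≠ 0 := by nlinarith [norm_nonneg w]
  rcases mul_eq_zero.mp this.symm with h | h
  · exact absurd (Quaternion.coe_injective (by simpa using h)) hne
  · exact h


def cj (F : PS) : PS := mk fun m => star (coeff m F)

theorem cj_mul (F G : PS) : cj (F * G) = cj G * cj F := by
  ext1 m
  rw [cj, coeff_mk, coeff_mul, coeff_mul, star_sum, ← Finset.Nat.sum_antidiagonal_swap]
  apply Finset.sum_congr rfl
  intro x _
  simp [cj]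

theorem SA_cj {F : PS} {r : ℝ} (h : SA F r) : SA (cj F) r := by
  refine Summable.congr h fun m => ?_
  simp [cj]

theorem SelfMap.sa {a : ℕ → H} (ha : SelfMap a) {r : ℝ} (h0 : 0 ≤ r) (h1 : r < 1) : SA (mk a) r := by
  have h := (ha.1 (r : H) (by simpa [abs_of_nonneg h0] using h1)).norm
  refine Summable.congr h fun m => ?_
  simp [abs_of_nonneg h0, mul_comm]

theorem pow_lin (q : H) (m : ℕ) : ∃ α β : ℝ, q ^ m = α + β * q ∧ star q ^ m = α + β * star q := by
  induction m with
  | zero => exact ⟨1, 0, by simp, by simp⟩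
  | succ m ih =>
    obtain ⟨α, β, h1, h2⟩ := ih
    refine ⟨-(β * ‖q‖ ^ 2), α + β * (2 * q.re), ?_, ?_⟩
    · rw [pow_succ, h1, add_mul, mul_assoc, q_sq]; push_cast; noncomm_ring
    · have := q_sq (star q)
      rw [pow_succ, h2, add_mul, mul_assoc, this, norm_star, Quaternion.re_star]; push_cast; noncomm_ring

theorem _root_.HasSum.congr_fun' {f g : ℕ → H} {S : H} (h : HasSum g S) (e : ∀ m, f m = g m) : HasSum f S := by
  rw [funext e]; exact h

theorem A2R {a : ℕ → H} (ha : SelfMap a) {q : H} (hq : ‖q‖ < 1) :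
    ∃ S, HasSum (fun m => a m * q ^ m) S ∧ ‖S‖ ≤ 1 := by
  have hE : ∀ q : H, ‖q‖ < 1 → HasSum (fun m => q ^ m * a m) (evalC a q) := fun q hq => (ha.1 q hq).hasSum
  by_cases h0 : q - star q = 0
  · have hqr : (q.re : H) = q := Quaternion.star_eq_self.mp (sub_eq_zero.mp h0).symm |>.symm
    refine ⟨evalC a q, ?_, (ha.2 q hq).le⟩
    convert hE q hq using 2 with m
    rw [← hqr, ← Quaternion.coe_pow, Quaternion.coe_commutes]
  · choose α β h1 h2 using pow_lin q
    set B := (q - star q)⁻¹ * (evalC a q - evalC a (star q)) with hB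
    have hBs : HasSum (fun m => (β m : H) * a m) B := by
      have := ((hE q hq).sub (hE (star q) (by rwa [norm_star]))).mul_left (q - star q)⁻¹
      refine this.congr_fun' fun m => ?_
      rw [← sub_mul, h1, h2, ← mul_assoc, add_sub_add_left_eq_sub, ← mul_sub, Quaternion.coe_commutes (β m) (q - star q),
        inv_mul_cancel_left₀ h0]
    set A := evalC a q - q * B with hA
    have hAs : HasSum (fun m => (α m : H) * a m) A := by
      have := (hE q hq).sub (hBs.mul_left q)
      refine this.congr_fun' fun m => ?_
      rw [h1, ← mul_assoc q, ← Quaternion.coe_commutes, add_mul, add_sub_cancel_right]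
    have hR : HasSum (fun m => a m * q ^ m) (A + B * q) := by
      have := hAs.add (hBs.mul_right q)
      refine this.congr_fun' fun m => ?_
      rw [h1, mul_add, ← Quaternion.coe_commutes, ← mul_assoc, ← Quaternion.coe_commutes]
    refine ⟨_, hR, ?_⟩
    by_cases hA0 : A = 0
    · rw [hA0, zero_add, norm_mul, mul_comm, ← norm_mul]
      have : q * B = evalC a q := by rw [eq_comm, ← sub_eq_zero, ← hA, hA0]
      rw [this]; exact (ha.2 q hq).le
    · set q' := A * q * A⁻¹ with hq'
      have hq'n : ‖q'‖ < 1 := by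
        have := norm_ne_zero_iff.mpr hA0
        rw [hq', norm_mul, norm_mul, norm_inv]
        field_simp; exact hq
      have hp : ∀ m, q' ^ m = α m + β m * q' := by
        intro m
        have : q' ^ m = A * q ^ m * A⁻¹ := by
          induction m with
          | zero => simp [hA0]
          | succ m ih => rw [pow_succ, ih, hq', pow_succ]; simp only [mul_assoc, inv_mul_cancel_left₀ hA0]
        rw [this, h1, mul_add, add_mul, ← Quaternion.coe_commutes, mul_assoc _ A, mul_inv_cancel₀ hA0, mul_one,
          ← mul_assoc A, ← Quaternion.coe_commutes, hq']
        simp only [mul_assoc]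
      have hs : HasSum (fun m => q' ^ m * a m) (A + q' * B) := by
        have := hAs.add (hBs.mul_left q')
        refine this.congr_fun' fun m => ?_
        rw [hp, add_mul, ← mul_assoc q', ← Quaternion.coe_commutes]
      have e : evalC a q' = A + q' * B := hs.tsum_eq
      have hn : ‖A + B * q‖ = ‖A + q' * B‖ := by
        have e1 : A + B * q = A * (1 - (-(A⁻¹ * B)) * q) := by
          rw [mul_sub, mul_one, neg_mul, mul_neg, sub_neg_eq_add, mul_assoc A⁻¹, mul_inv_cancel_left₀ hA0]
        have e2 : A + q' * B = A * (1 - q * (-(A⁻¹ * B))) := by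
          rw [mul_sub, mul_one, mul_neg, mul_neg, sub_neg_eq_add, hq']; simp only [mul_assoc]
        rw [e1, e2, norm_mul, norm_mul, norm_one_sub_comm]
      rw [hn, ← e]; exact (ha.2 q' hq'n).le

theorem A2 {a : ℕ → H} (ha : SelfMap a) {q : H} (hq : ‖q‖ < 1) : ‖ev (cj (mk a)) q‖ ≤ 1 := by
  obtain ⟨S, hS, hn⟩ := A2R ha (q := star q) (by rwa [norm_star])
  have := hS.star
  have e : ev (cj (mk a)) q = star S := by
    rw [ev, evalC, ← this.tsum_eq]
    congr 1; funext m; simp [cj]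
  rw [e, norm_star]; exact hn

theorem re_comm (x y : H) : (x * y).re = (y * x).re := by
  simp; ring

theorem re_sum (s : Finset ℕ) (f : ℕ → H) : (∑ i ∈ s, f i).re = ∑ i ∈ s, (f i).re := by
  classical
  induction s using Finset.induction_on with
  | empty => rfl
  | insert i s hi ih => rw [Finset.sum_insert hi, Finset.sum_insert hi, Quaternion.re_add, ih]

theorem parseval {N : ℕ} {ω : H} (h1 : star ω * ω = 1) (hω : ω ^ N = 1)
    (hinj : ∀ m < N, ∀ l < N, ω ^ m = ω ^ l → m = l) (d : ℕ → H) :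
    ∑ j ∈ Finset.range N, ‖∑ m ∈ Finset.range N, (ω ^ j) ^ m * d m‖ ^ 2 =
      N * ∑ m ∈ Finset.range N, ‖d m‖ ^ 2 := by
  have h1' : ω * star ω = 1 := by rw [sq_star, ← star_sq, h1]
  have hn : ∀ v : H, ‖v‖ ^ 2 = (v * star v).re := fun v => by rw [sq_star, Quaternion.re_coe]
  have hcomm : Commute (star ω) ω := by rw [commute_iff_eq, h1, h1']
  have hx : ∀ m < N, ∀ l < N, ∑ j ∈ Finset.range N, (star ω ^ l * ω ^ m) ^ j = if m = l then (N : H) else 0 := by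
    intro m hm l hl
    have hl1 : star ω ^ l * ω ^ l = 1 := by rw [← hcomm.mul_pow, h1, one_pow]
    have hl2 : ω ^ l * star ω ^ l = 1 := by rw [← hcomm.symm.mul_pow, h1', one_pow]
    split_ifs with hml
    · subst hml; rw [hl1]; simp
    · have hx1 : star ω ^ l * ω ^ m - 1 ≠ 0 := by
        intro h
        apply hml
        apply hinj m hm l hl
        have := congrArg (ω ^ l * ·) (sub_eq_zero.mp h)
        simpa [← mul_assoc, hl2] using this
      have hxN : (star ω ^ l * ω ^ m) ^ N = 1 := by
        rw [(hcomm.pow_pow l m).mul_pow, ← pow_mul, ← pow_mul, mul_comm l, mul_comm m, pow_mul, pow_mul, hω,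
          ← star_pow, hω]; simp
      have := geom_sum_mul (star ω ^ l * ω ^ m) N
      rw [hxN, sub_self] at this
      exact (mul_eq_zero.mp this).resolve_right hx1
  have hterm : ∀ j, ‖∑ m ∈ Finset.range N, (ω ^ j) ^ m * d m‖ ^ 2 =
      ∑ m ∈ Finset.range N, ∑ l ∈ Finset.range N, ((star ω ^ l * ω ^ m) ^ j * (d m * star (d l))).re := by
    intro j
    rw [hn, star_sum, Finset.sum_mul_sum, re_sum]
    apply Finset.sum_congr rfl; intro m _
    rw [re_sum]
    apply Finset.sum_congr rfl; intro l _
    rw [star_mul, ← mul_assoc, re_comm, (hcomm.pow_pow l m).mul_pow, star_pow, star_pow, ← pow_mul, ← pow_mul,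
      ← pow_mul, ← pow_mul, mul_comm j, mul_comm j]
    simp only [mul_assoc]
  simp_rw [hterm]
  rw [Finset.sum_comm, Finset.mul_sum]
  apply Finset.sum_congr rfl; intro m hm
  rw [Finset.sum_comm, Finset.sum_eq_single m]
  · rw [← re_sum, ← Finset.sum_mul, hx m (Finset.mem_range.mp hm) m (Finset.mem_range.mp hm), if_pos rfl, hn]
    have : (N : H) = ((N : ℝ) : H) := (Quaternion.coe_natCast N).symm
    rw [this, Quaternion.coe_mul_eq_smul, Quaternion.re_smul, smul_eq_mul]
  · intro l hl hlm
    rw [← re_sum, ← Finset.sum_mul, hx m (Finset.mem_range.mp hm) l (Finset.mem_range.mp hl), if_neg (Ne.symm hlm), zero_mul]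
    rfl
  · intro h; exact absurd hm h

theorem exists_root {N : ℕ} (hN : N ≠ 0) : ∃ ω : H, star ω * ω = 1 ∧ ω ^ N = 1 ∧
    ∀ m < N, ∀ l < N, ω ^ m = ω ^ l → m = l := by
  have hp := Complex.isPrimitiveRoot_exp N hN
  set z := Complex.exp (2 * Real.pi * Complex.I / N)
  have hpow : (Quaternion.ofComplex z) ^ N = 1 := by rw [← map_pow, hp.pow_eq_one, map_one]
  refine ⟨Quaternion.ofComplex z, ?_, hpow, ?_⟩
  · have : ‖Quaternion.ofComplex z‖ ^ N = 1 := by rw [← norm_pow, hpow, norm_one]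
    rw [star_sq, (pow_eq_one_iff_of_nonneg (norm_nonneg _) hN).mp this]; simp
  · intro m hm l hl h
    rw [← map_pow, ← map_pow] at h
    have hi : Function.Injective Quaternion.ofComplex := RingHom.injective (Quaternion.ofComplex : ℂ →+* Quaternion ℝ)
    exact hp.pow_inj hm hl (hi h)



theorem ev_tail {G : PS} {q : H} (h : SA G ‖q‖) (N : ℕ) :
    ‖∑ m ∈ Finset.range N, q ^ m * coeff m G‖ ≤ ‖ev G q‖ + ∑' m, ‖coeff (m + N) G‖ * ‖q‖ ^ (m + N) := by
  have h1 := h.summable.sum_add_tsum_nat_add N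
  have h2 : ‖∑' m, q ^ (m + N) * coeff (m + N) G‖ ≤ ∑' m, ‖coeff (m + N) G‖ * ‖q‖ ^ (m + N) := by
    have hs : Summable fun m => ‖coeff (m + N) G‖ * ‖q‖ ^ (m + N) := (summable_nat_add_iff N).mpr h
    apply tsum_of_norm_bounded hs.hasSum
    intro m; rw [norm_mul, norm_pow, mul_comm]
  have h3 : ∑ m ∈ Finset.range N, q ^ m * coeff m G = ev G q - ∑' m, q ^ (m + N) * coeff (m + N) G := by
    rw [ev, evalC, ← h1]; abel
  rw [h3]
  exact (norm_sub_le _ _).trans (by linarith)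

theorem SA_tr (n : ℕ) (k : PS) (r : ℝ) : SA (tr n k) r := by
  apply summable_of_ne_finset_zero (s := Finset.range n)
  intro m hm
  simp [tr, Finset.mem_range.not.mp hm]

theorem Schur_bound {a : ℕ → H} (ha : SelfMap a) (n : ℕ) (k : PS) {r : ℝ} (h0 : 0 < r) (h1 : r < 1) :
    ∑ m ∈ Finset.range n, (r ^ m) ^ 2 * ‖coeff m (mk a * tr n k)‖ ^ 2 ≤ NN n k := by
  set F := (mk a : PS)
  set K := cj (tr n k) with hK
  set G := cj (F * tr n k) with hG
  have hGm : G = K * cj F := cj_mul _ _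
  have hsF : SA (cj F) r := SA_cj (ha.sa h0.le h1)
  have hsK : SA K r := SA_cj (SA_tr n k r)
  have hsG : SA G r := by rw [hGm]; exact SA.mul h0.le hsK hsF
  set M := ∑ m ∈ Finset.range n, ‖coeff m K‖ with hM
  have hM0 : 0 ≤ M := Finset.sum_nonneg fun _ _ => norm_nonneg _
  set T : ℕ → ℝ := fun N => ∑' m, ‖coeff (m + N) G‖ * r ^ (m + N) with hT
  have hT0 : ∀ N, 0 ≤ T N := fun N => tsum_nonneg fun m => by positivity
  have hTl : Filter.Tendsto T Filter.atTop (nhds 0) := tendsto_sum_nat_add (fun m => ‖coeff m G‖ * r ^ m)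
  have hbd : ∀ N, n ≤ N → N ≠ 0 → ∑ m ∈ Finset.range n, (r ^ m) ^ 2 * ‖coeff m (F * tr n k)‖ ^ 2 ≤
      NN n k + (2 * M * T N + T N ^ 2) := by
    intro N hn hN
    obtain ⟨ω, w1, w2, w3⟩ := exists_root hN
    have hω : ‖ω‖ = 1 := by
      have : ‖ω‖ ^ N = 1 := by rw [← norm_pow, w2, norm_one]
      exact (pow_eq_one_iff_of_nonneg (norm_nonneg _) hN).mp this
    have hN' : (0 : ℝ) < N := by positivity
    have hz : ∀ j : ℕ, ‖(r : H) * ω ^ j‖ = r := by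
      intro j; rw [norm_mul, norm_pow, hω]; simp [abs_of_pos h0]
    have hzp : ∀ (j m : ℕ) (x : H), ((r : H) * ω ^ j) ^ m * x = (ω ^ j) ^ m * (((r ^ m : ℝ) : H) * x) := by
      intro j m x
      have hc : Commute (r : H) (ω ^ j) := Quaternion.coe_commutes r _
      rw [hc.mul_pow, ← mul_assoc, ← Quaternion.coe_pow, Quaternion.coe_commutes]
    have hKe : ∀ j, ev K ((r : H) * ω ^ j) = ∑ m ∈ Finset.range N, (ω ^ j) ^ m * (((r ^ m : ℝ) : H) * coeff m K) := by
      intro j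
      rw [ev, evalC, tsum_eq_sum (s := Finset.range N)]
      · exact Finset.sum_congr rfl fun m _ => hzp j m _
      · intro m hm
        have : ¬ m < n := fun h => hm (Finset.mem_range.mpr (h.trans_le hn))
        simp [hK, cj, tr, this]
    have hKM : ∀ j, ‖ev K ((r : H) * ω ^ j)‖ ≤ M := by
      intro j
      rw [hKe, ← Finset.sum_subset (Finset.range_mono hn)]
      · refine (norm_sum_le _ _).trans (Finset.sum_le_sum fun m _ => ?_)
        rw [norm_mul, norm_mul, norm_pow, norm_pow, hω, Quaternion.norm_coe, Real.norm_eq_abs, abs_of_pos (by positivity)]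
        have := pow_le_one₀ (n := m) h0.le h1.le
        simp only [one_pow, one_mul]
        nlinarith [norm_nonneg (coeff m K)]
      · intro m _ hm
        have : ¬ m < n := fun h => hm (Finset.mem_range.mpr h)
        simp [hK, cj, tr, this]
    have hGK : ∀ j, ‖ev G ((r : H) * ω ^ j)‖ ≤ ‖ev K ((r : H) * ω ^ j)‖ := by
      intro j
      have a1 : SA K ‖(r : H) * ω ^ j‖ := by rw [hz]; exact hsK
      have a2 : SA (cj F) ‖(r : H) * ω ^ j‖ := by rw [hz]; exact hsF
      rw [hGm]
      by_cases hy : ev K ((r : H) * ω ^ j) = 0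
      · rw [ev_zero_mul a1 a2 hy, hy]
      · rw [ev_conj a1 a2 hy, norm_mul]
        have : ‖(ev K ((r : H) * ω ^ j))⁻¹ * ((r : H) * ω ^ j) * ev K ((r : H) * ω ^ j)‖ < 1 := by
          have h := norm_ne_zero_iff.mpr hy
          rw [norm_mul, norm_mul, norm_inv, hz]; field_simp; exact h1
        have := A2 ha this
        nlinarith [norm_nonneg (ev K ((r : H) * ω ^ j))]
    have hjb : ∀ j, ‖∑ m ∈ Finset.range N, (ω ^ j) ^ m * (((r ^ m : ℝ) : H) * coeff m G)‖ ^ 2 ≤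
        ‖∑ m ∈ Finset.range N, (ω ^ j) ^ m * (((r ^ m : ℝ) : H) * coeff m K)‖ ^ 2 + (2 * M * T N + T N ^ 2) := by
      intro j
      have a3 : SA G ‖(r : H) * ω ^ j‖ := by rw [hz]; exact hsG
      have h := ev_tail a3 N
      rw [hz] at h
      have e : ∑ m ∈ Finset.range N, (ω ^ j) ^ m * (((r ^ m : ℝ) : H) * coeff m G) =
        ∑ m ∈ Finset.range N, ((r : H) * ω ^ j) ^ m * coeff m G := Finset.sum_congr rfl fun m _ => (hzp j m _).symm
      rw [e, ← hKe]
      have h4 : ‖∑ m ∈ Finset.range N, ((r : H) * ω ^ j) ^ m * coeff m G‖ ≤ ‖ev K ((r : H) * ω ^ j)‖ + T N :=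
        h.trans (by have := hGK j; simp only [hT]; linarith)
      have h5 := pow_le_pow_left₀ (norm_nonneg _) h4 2
      have h6 := mul_le_mul_of_nonneg_right (hKM j) (hT0 N)
      nlinarith
    have hsum := Finset.sum_le_sum fun j (_ : j ∈ Finset.range N) => hjb j
    rw [Finset.sum_add_distrib, parseval w1 w2 w3, parseval w1 w2 w3, Finset.sum_const, Finset.card_range,
      nsmul_eq_mul, ← mul_add] at hsum
    have hs2 := le_of_mul_le_mul_left hsum hN'
    have e1 : ∑ m ∈ Finset.range n, (r ^ m) ^ 2 * ‖coeff m (F * tr n k)‖ ^ 2 ≤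
        ∑ m ∈ Finset.range N, ‖((r ^ m : ℝ) : H) * coeff m G‖ ^ 2 := by
      have : ∀ m, ‖((r ^ m : ℝ) : H) * coeff m G‖ ^ 2 = (r ^ m) ^ 2 * ‖coeff m (F * tr n k)‖ ^ 2 := by
        intro m
        rw [norm_mul, mul_pow, hG, cj, coeff_mk, norm_star, Quaternion.norm_coe, Real.norm_eq_abs, sq_abs]
      simp_rw [this]
      exact Finset.sum_le_sum_of_subset_of_nonneg (Finset.range_mono hn) fun _ _ _ => by positivity
    have e2 : ∑ m ∈ Finset.range N, ‖((r ^ m : ℝ) : H) * coeff m K‖ ^ 2 ≤ NN n k := by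
      rw [← NN_tr hn k, NN]
      apply Finset.sum_le_sum
      intro m _
      have := pow_le_one₀ (n := m) h0.le h1.le
      have h7 : (r ^ m) ^ 2 ≤ 1 := pow_le_one₀ (by positivity) this
      rw [norm_mul, mul_pow, hK, cj, coeff_mk, norm_star, Quaternion.norm_coe, Real.norm_eq_abs, sq_abs]
      nlinarith [sq_nonneg ‖coeff m (tr n k)‖]
    linarith
  have hlim : Filter.Tendsto (fun N => NN n k + (2 * M * T N + T N ^ 2)) Filter.atTop (nhds (NN n k + (2 * M * 0 + 0 ^ 2))) :=
    tendsto_const_nhds.add ((tendsto_const_nhds.mul hTl).add (hTl.pow 2))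
  have := ge_of_tendsto hlim (Filter.eventually_atTop.mpr ⟨n + 1, fun N hN => hbd N (by omega) (by omega)⟩)
  simpa using this

theorem Schur_of_SelfMap {a : ℕ → H} (ha : SelfMap a) : Schur (mk a) := by
  intro n k
  rw [← NN_mul_tr]
  have hc : Continuous fun r : ℝ => ∑ m ∈ Finset.range n, (r ^ m) ^ 2 * ‖coeff m (mk a * tr n k)‖ ^ 2 := by fun_prop
  have hl := (hc.tendsto 1).mono_left (nhdsWithin_le_nhds (s := Set.Iio 1))
  have hev : ∀ᶠ r in nhdsWithin (1 : ℝ) (Set.Iio 1),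
      ∑ m ∈ Finset.range n, (r ^ m) ^ 2 * ‖coeff m (mk a * tr n k)‖ ^ 2 ≤ NN n k := by
    filter_upwards [Ioo_mem_nhdsLT (show (0:ℝ) < 1 by norm_num)] with r hr
    exact Schur_bound ha n k hr.1 hr.2
  have := le_of_tendsto hl hev
  simpa [NN] using this



theorem evalC_ev (a : ℕ → H) (q : H) : evalC a q = ev (mk a) q := by simp [ev]

theorem IsMob_schur {g : PS} (h : IsMob g) : Schur g := by
  obtain ⟨t, u, ht, hu, h⟩ := h
  rw [eq_Mo_mul h.symm]
  exact (Schur_Mo ht).mul (Schur.C hu.le)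

theorem ev_Mo_mul_norm {s q : H} (hs : ‖s‖ < 1) (hq : ‖q‖ < 1) (u : H) (hu : ‖u‖ = 1) :
    ‖ev (Mo s * C u) q‖ = ‖ev (Mo s) q‖ := by
  rw [ev_mul_C ((Schur_Mo hs).sa hq), norm_mul, hu, mul_one]

theorem main_aux (a : ℕ → H) (ha : SelfMap a)
    (hnot : ¬ IsBlaschke a 1) (p s : H) (hp : ‖p‖ < 1) (hs : ‖s‖ < 1) :
    ((∃ q : H, ‖q‖ < 1 ∧ q ≠ s ∧
        ‖evalC (bulletC (evalC (hdqC a p) s) (hdqC a p)) q‖ = ‖mobiusEval s q‖) ↔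
      IsBlaschke a 2) ∧
    (IsBlaschke a 2 → ∀ q : H, ‖q‖ < 1 →
      ‖evalC (bulletC (evalC (hdqC a p) s) (hdqC a p)) q‖ = ‖mobiusEval s q‖) := by
  have hF := Schur_of_SelfMap ha
  rw [isBlaschke_one] at hnot
  have hlt : ∀ r : H, ‖r‖ < 1 → ‖ev (mk a) r‖ < 1 := fun r hr => by rw [← evalC_ev]; exact ha.2 r hr
  have hnc : ∀ (r : H), ‖r‖ < 1 → ∀ G u, HD (mk a) r (ev (mk a) r) G → ‖u‖ = 1 → G ≠ C u := by
    intro r hr G u hG hu h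
    rw [h] at hG
    exact hnot (inversion hr (hlt r hr) hu hG)
  have hgHD := hdq_HD hF hp (ha.2 p hp)
  rw [evalC_ev a p] at hgHD
  set g : PS := mk (hdqC a p) with hg
  have hgs : Schur g := HD_schur hF hp (hlt p hp) hgHD
  have hwE := E_lemma hgs hs
  have hw : ‖ev g s‖ < 1 := lt_of_le_of_ne hwE.1 fun h => hnc p hp g _ hgHD h (hwE.2 h)
  obtain ⟨G, hG⟩ := exists_HD hgs hs hw
  have hGs : Schur G := HD_schur hgs hs hw hG
  obtain ⟨F', -, h2, h3, h4⟩ := HD_bullet hgs hw hG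
  have hev : ∀ q, evalC (bulletC (evalC (hdqC a p) s) (hdqC a p)) q = ev (Mo s * G) q := by
    intro q
    rw [evalC_ev, evalC_ev, bullet_eq hgs hw h2, eq_Mo_mul h3]
  have hgen : IsBlaschke a 2 → ∀ q : H, ‖q‖ < 1 →
      ‖evalC (bulletC (evalC (hdqC a p) s) (hdqC a p)) q‖ = ‖mobiusEval s q‖ := by
    intro hB q hq
    obtain ⟨t, g0, ht, hgM, hE⟩ := (isBlaschke_two a).mp hB
    have hg0 := IsMob_schur hgM
    have hFe : mk a = Mo t * g0 := eq_Mo_mul hE.symm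
    have hFt : ev (mk a) t = 0 := by
      rw [hFe]
      refine ev_zero_mul ((Schur_Mo ht).sa ht) (hg0.sa ht) ?_
      have h := ev_mul_oneSub ((Schur_Mo ht).sa ht) (star t)
      have h2 : Mo t * (1 - X * C (star t)) = lin t := mobius_den t
      rw [h2, ev_lin, sub_self] at h
      exact fix_zero ht (by rw [norm_star]; exact ht.le) h.symm
    have hHD : HD (mk a) t (ev (mk a) t) g0 := by
      rw [hFt, HD]; simpa using hE.symm
    rcases general hF ht hp (hlt t ht) (hlt p hp) hHD hgM hgHD with h | ⟨u, hu, h⟩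
    · obtain ⟨u, hu, h⟩ := mob_const hgs h hs hw hG
      rw [hev, h, ev_Mo_mul_norm hs hq u hu, mobiusEval_eq hs hq]
    · exact absurd h (hnc p hp g u hgHD hu)
  refine ⟨⟨?_, ?_⟩, hgen⟩
  · rintro ⟨q, hq, hqs, heq⟩
    have hy := ev_Mo_ne hs hq hqs
    have hyn := norm_ne_zero_iff.mpr hy
    rw [hev, mobiusEval_eq hs hq, ev_conj ((Schur_Mo hs).sa hq) (hGs.sa hq) hy, norm_mul] at heq
    have hn1 : ‖ev G ((ev (Mo s) q)⁻¹ * q * ev (Mo s) q)‖ = 1 := by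
      exact mul_left_cancel₀ hyn (by rw [heq, mul_one])
    have hcn : ‖(ev (Mo s) q)⁻¹ * q * ev (Mo s) q‖ < 1 := by
      rw [norm_mul, norm_mul, norm_inv]; field_simp; exact hq
    have hGc := (E_lemma hGs hcn).2 hn1
    rw [hGc] at hG
    have hgM : IsMob g := inversion hs hw hn1 hG
    have h0 : ‖(0 : H)‖ < 1 := by simp
    obtain ⟨g1, hg1⟩ := exists_HD hF h0 (hlt 0 h0)
    have hg1M : IsMob g1 := by
      rcases general hF hp h0 (hlt p hp) (hlt 0 h0) hgHD hgM hg1 with h | ⟨u, hu, h⟩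
      · exact h
      · exact absurd h (hnc 0 h0 g1 u hg1 hu)
    obtain ⟨t, ht, ht0⟩ := zero_exists hF (hlt 0 h0) hg1 hg1M (IsMob_schur hg1M)
    obtain ⟨g2, hg2⟩ := exists_HD hF ht (hlt t ht)
    have hg2M : IsMob g2 := by
      rcases general hF h0 ht (hlt 0 h0) (hlt t ht) hg1 hg1M hg2 with h | ⟨u, hu, h⟩
      · exact h
      · exact absurd h (hnc t ht g2 u hg2 hu)
    rw [isBlaschke_two]
    refine ⟨t, g2, ht, hg2M, ?_⟩
    rw [ht0, HD] at hg2
    simpa using hg2.symm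
  · intro hB
    obtain ⟨q, hq, hqs⟩ : ∃ q : H, ‖q‖ < 1 ∧ q ≠ s := by
      by_cases h : s = 0
      · refine ⟨((1 / 2 : ℝ) : H), ?_, ?_⟩
        · rw [Quaternion.norm_coe]; norm_num
        · rw [h]
          intro h'
          have := congrArg norm h'
          rw [Quaternion.norm_coe] at this
          norm_num at this
      · exact ⟨0, by simp, Ne.symm h⟩
    exact ⟨q, hq, hqs, hgen hB q hq⟩



end

/-- Equality in the three-points Schwarz–Pick Lemma at some `q ≠ s` holds iff
`f` is a regular Blaschke product of degree `2`, and then it holds everywhere. -/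
theorem threePoints_schwarzPick_equality (a : ℕ → H) (ha : SelfMap a)
    (hnot : ¬ IsBlaschke a 1) (p s : H) (hp : ‖p‖ < 1) (hs : ‖s‖ < 1) :
    ((∃ q : H, ‖q‖ < 1 ∧ q ≠ s ∧
        ‖evalC (bulletC (evalC (hdqC a p) s) (hdqC a p)) q‖ = ‖mobiusEval s q‖) ↔
      IsBlaschke a 2) ∧
    (IsBlaschke a 2 → ∀ q : H, ‖q‖ < 1 →
      ‖evalC (bulletC (evalC (hdqC a p) s) (hdqC a p)) q‖ = ‖mobiusEval s q‖) := by
  exact main_aux a ha hnot p s hp hs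

end QPaper
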